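/- Let n ≥ 1, let Ω ⊂ ℝ^n be open, let 1 ≤ p < ∞, and let f ∈ L^1_loc(Ω). Then there exists a family {f_ε}_{ε>0} with f_ε − f ∈ L^p_loc(Ω), f_ε − f → 0 in L^p_loc(Ω) as ε → 0, and limsup_{ε→0} κ_ε(f_ε, Ω) ≤ (1/4)·Var(f, Ω). -/

import Mathlib

open MeasureTheory Filter Topology Metric
open scoped ENNReal RealInnerProductSpace Classical

noncomputable section

/-- An open cube in `ℝⁿ` with side length `ε` and arbitrary orientation. -/
def IsCube (n : ℕ) (ε : ℝ) (Q : Set (EuclideanSpace ℝ (Fin n))) : Prop :=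
  ∃ (T : EuclideanSpace ℝ (Fin n) ≃ₗᵢ[ℝ] EuclideanSpace ℝ (Fin n))
    (x : EuclideanSpace ℝ (Fin n)),
    Q = (fun y => x + T y) '' {y : EuclideanSpace ℝ (Fin n) | ∀ i, |y i| < ε / 2}

/-- The BMO-type functional `κ_ε(f, Ω)`. -/
def kappa (n : ℕ) (ε : ℝ) (f : EuclideanSpace ℝ (Fin n) → ℝ)
    (Ω : Set (EuclideanSpace ℝ (Fin n))) : ℝ≥0∞ :=
  ENNReal.ofReal (ε ^ (n - 1)) *
    ⨆ (F : Set (Set (EuclideanSpace ℝ (Fin n))))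
      (_ : ∀ Q ∈ F, IsCube n ε Q ∧ Q ⊆ Ω) (_ : F.Pairwise Disjoint),
      ∑' Q : F, ENNReal.ofReal
        (⨍ x in (Q : Set (EuclideanSpace ℝ (Fin n))),
          |f x - ⨍ y in (Q : Set (EuclideanSpace ℝ (Fin n))), f y ∂volume| ∂volume)

/-- The divergence of a vector field on `ℝⁿ`. -/
def vdiv (n : ℕ) (Φ : EuclideanSpace ℝ (Fin n) → EuclideanSpace ℝ (Fin n))
    (x : EuclideanSpace ℝ (Fin n)) : ℝ :=
  ∑ i : Fin n, fderiv ℝ Φ x (EuclideanSpace.single i 1) i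

/-- The variation `Var(f, Ω)`. -/
def variation (n : ℕ) (f : EuclideanSpace ℝ (Fin n) → ℝ)
    (Ω : Set (EuclideanSpace ℝ (Fin n))) : ℝ≥0∞ :=
  ⨆ (Φ : EuclideanSpace ℝ (Fin n) → EuclideanSpace ℝ (Fin n))
    (_ : ContDiff ℝ 1 Φ) (_ : HasCompactSupport Φ) (_ : tsupport Φ ⊆ Ω)
    (_ : ∀ x, ‖Φ x‖ ≤ 1),
    ENNReal.ofReal (∫ x in Ω, f x * vdiv n Φ x)

/-- The approximate jump set `J_f`. -/
def jumpSet (n : ℕ) (f : EuclideanSpace ℝ (Fin n) → ℝ) : Set (EuclideanSpace ℝ (Fin n)) :=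
  {x | ∃ ν : EuclideanSpace ℝ (Fin n), ‖ν‖ = 1 ∧ ∃ a b : ℝ, a ≠ b ∧
    Tendsto (fun r : ℝ =>
        ⨍ y in {y ∈ ball x r | 0 < ⟪y - x, ν⟫}, |f y - a| ∂volume)
      (𝓝[>] 0) (𝓝 0) ∧
    Tendsto (fun r : ℝ =>
        ⨍ y in {y ∈ ball x r | ⟪y - x, ν⟫ < 0}, |f y - b| ∂volume)
      (𝓝[>] 0) (𝓝 0)}

/-- The approximate discontinuity set `S_f` (the set of non-Lebesgue points). -/
def approxDiscontSet (n : ℕ) (f : EuclideanSpace ℝ (Fin n) → ℝ) :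
    Set (EuclideanSpace ℝ (Fin n)) :=
  {x | ¬ ∃ c : ℝ,
    Tendsto (fun r : ℝ => ⨍ y in ball x r, |f y - c| ∂volume) (𝓝[>] 0) (𝓝 0)}

/-- `(μ, σ)` is the polar decomposition `Df = σ |Df|` of the gradient measure of `f` on `Ω`:
`μ` plays the role of the total variation measure `|Df|` and `σ` of the polar vector field. -/
def IsVariationPair (n : ℕ) (f : EuclideanSpace ℝ (Fin n) → ℝ)
    (Ω : Set (EuclideanSpace ℝ (Fin n))) (μ : Measure (EuclideanSpace ℝ (Fin n)))
    (σ : EuclideanSpace ℝ (Fin n) → EuclideanSpace ℝ (Fin n)) : Prop :=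
  IsFiniteMeasure μ ∧ μ Ωᶜ = 0 ∧ AEStronglyMeasurable σ μ ∧ (∀ᵐ x ∂μ, ‖σ x‖ = 1) ∧
  ∀ Φ : EuclideanSpace ℝ (Fin n) → EuclideanSpace ℝ (Fin n),
    ContDiff ℝ 1 Φ → HasCompactSupport Φ → tsupport Φ ⊆ Ω →
    ∫ x in Ω, f x * vdiv n Φ x = - ∫ x, ⟪Φ x, σ x⟫ ∂μ

/-- `|D^a f|(Ω)`, the total variation of the absolutely continuous part of `Df`,
with the convention that it is `∞` if `f` is not of bounded variation in `Ω`. -/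
def absVar (n : ℕ) (f : EuclideanSpace ℝ (Fin n) → ℝ)
    (Ω : Set (EuclideanSpace ℝ (Fin n))) : ℝ≥0∞ :=
  if h : ∃ p : Measure (EuclideanSpace ℝ (Fin n)) ×
      (EuclideanSpace ℝ (Fin n) → EuclideanSpace ℝ (Fin n)),
      IsVariationPair n f Ω p.1 p.2 then
    volume.withDensity ((h.choose.1).rnDeriv volume) Ω
  else ⊤

/-- `|D^c f|(Ω)`, the total variation of the Cantor part of `Df`,
with the convention that it is `∞` if `f` is not of bounded variation in `Ω`. -/
def cantorVar (n : ℕ) (f : EuclideanSpace ℝ (Fin n) → ℝ)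
    (Ω : Set (EuclideanSpace ℝ (Fin n))) : ℝ≥0∞ :=
  if h : ∃ p : Measure (EuclideanSpace ℝ (Fin n)) ×
      (EuclideanSpace ℝ (Fin n) → EuclideanSpace ℝ (Fin n)),
      IsVariationPair n f Ω p.1 p.2 then
    (h.choose.1.singularPart volume) (Ω \ approxDiscontSet n f)
  else ⊤

/-- `|D^j f|(Ω)`, the total variation of the jump part of `Df`,
with the convention that it is `∞` if `f` is not of bounded variation in `Ω`. -/
def jumpVar (n : ℕ) (f : EuclideanSpace ℝ (Fin n) → ℝ)
    (Ω : Set (EuclideanSpace ℝ (Fin n))) : ℝ≥0∞ :=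
  if h : ∃ p : Measure (EuclideanSpace ℝ (Fin n)) ×
      (EuclideanSpace ℝ (Fin n) → EuclideanSpace ℝ (Fin n)),
      IsVariationPair n f Ω p.1 p.2 then
    (h.choose.1.singularPart volume) (jumpSet n f ∩ Ω)
  else ⊤

/-- `g` is the weak (distributional) gradient of `u` on `Ω`. -/
def HasWeakGradientOn (n : ℕ) (u : EuclideanSpace ℝ (Fin n) → ℝ)
    (g : EuclideanSpace ℝ (Fin n) → EuclideanSpace ℝ (Fin n))
    (Ω : Set (EuclideanSpace ℝ (Fin n))) : Prop :=
  ∀ φ : EuclideanSpace ℝ (Fin n) → ℝ,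
    ContDiff ℝ 1 φ → HasCompactSupport φ → tsupport φ ⊆ Ω →
    ∀ k : Fin n,
      ∫ x in Ω, u x * fderiv ℝ φ x (EuclideanSpace.single k 1) =
        - ∫ x in Ω, φ x * g x k

/-- `f ∈ BV(Ω)`: `f` is integrable on `Ω` and has finite variation in `Ω`. -/
def IsBVOn (n : ℕ) (f : EuclideanSpace ℝ (Fin n) → ℝ)
    (Ω : Set (EuclideanSpace ℝ (Fin n))) : Prop :=
  IntegrableOn f Ω volume ∧ variation n f Ω < ⊤

/-- `f ∈ SBV(Ω)`: `f ∈ BV(Ω)` and the Cantor part of `Df` vanishes. -/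
def IsSBVOn (n : ℕ) (f : EuclideanSpace ℝ (Fin n) → ℝ)
    (Ω : Set (EuclideanSpace ℝ (Fin n))) : Prop :=
  IsBVOn n f Ω ∧ cantorVar n f Ω = 0

lemma exists_smooth_dist {n : ℕ} {Ω : Set (EuclideanSpace ℝ (Fin n))} (hΩ : IsOpen Ω) :
    ∃ η : EuclideanSpace ℝ (Fin n) → ℝ, ContDiff ℝ 2 η ∧ (∀ x, 0 ≤ η x) ∧ (∀ x, η x ≤ 1) ∧
      Function.support η = Ω ∧ LipschitzWith 1 η := by
  have h1 : ∀ m : ℕ, ∃ g : EuclideanSpace ℝ (Fin n) → ℝ, Function.support g = Ω ∩ ball 0 (m : ℝ) ∧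
      ContDiff ℝ 2 g ∧ Set.range g ⊆ Set.Icc 0 1 := fun m =>
    (hΩ.inter isOpen_ball).exists_contDiff_support_eq (n := 2)
  choose g hg1 hg2 hg3 using h1
  have hg0 : ∀ m x, 0 ≤ g m x := fun m x => (hg3 m ⟨x, rfl⟩).1
  have hgc : ∀ m, HasCompactSupport (g m) := fun m => by
    refine HasCompactSupport.of_support_subset_isCompact
      (isCompact_closedBall (0 : EuclideanSpace ℝ (Fin n)) m) ?_
    rw [hg1 m]
    exact Set.inter_subset_right.trans ball_subset_closedBall
  have hR : ∀ m : ℕ, ∀ i : ℕ, ∃ R : ℝ, (i ≤ 2 → ∀ x, ‖iteratedFDeriv ℝ i (g m) x‖ ≤ R) := by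
    intro m i
    by_cases hi : i ≤ 2
    · have : BddAbove (Set.range fun x => ‖iteratedFDeriv ℝ i (g m) x‖) := by
        apply ((hg2 m).continuous_iteratedFDeriv
          (by exact_mod_cast hi)).norm.bddAbove_range_of_hasCompactSupport
        apply HasCompactSupport.comp_left _ norm_zero
        apply (hgc m).iteratedFDeriv
      rcases this with ⟨R, hR⟩
      exact ⟨R, fun _ x => hR (Set.mem_range_self _)⟩
    · exact ⟨0, fun h => absurd h hi⟩
  choose R hR using hR
  let M : ℕ → ℝ := fun m => 1 + |R m 0| + |R m 1| + |R m 2|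
  have hM : ∀ m, 0 < M m := fun m => by positivity
  have hRM : ∀ m i, i ≤ 2 → R m i ≤ M m := by
    intro m i hi
    simp only [M]
    have h0 := le_abs_self (R m 0)
    have h1 := le_abs_self (R m 1)
    have h2 := le_abs_self (R m 2)
    have h0' := abs_nonneg (R m 0)
    have h1' := abs_nonneg (R m 1)
    have h2' := abs_nonneg (R m 2)
    interval_cases i <;> linarith
  let r : ℕ → ℝ := fun m => (M m)⁻¹ * (1 / 2) ^ (m + 1)
  have hr : ∀ m, 0 < r m := fun m => by have := hM m; positivity
  have hbd : ∀ m i, i ≤ 2 → ∀ x, ‖iteratedFDeriv ℝ i (r m • g m) x‖ ≤ (1 / 2) ^ (m + 1) := by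
    intro m i hi x
    rw [iteratedFDeriv_const_smul_apply ((hg2 m).contDiffAt.of_le (by exact_mod_cast hi)),
      norm_smul, Real.norm_of_nonneg (hr m).le]
    calc r m * ‖iteratedFDeriv ℝ i (g m) x‖ ≤ r m * M m :=
          mul_le_mul_of_nonneg_left ((hR m i hi x).trans (hRM m i hi)) (hr m).le
      _ = (1 / 2) ^ (m + 1) := by
          have := (hM m).ne'
          simp only [r]; field_simp
  have hsum : HasSum (fun m : ℕ => ((1 : ℝ) / 2) ^ (m + 1)) 1 := by
    have := hasSum_geometric_two.mul_left (1 / 2 : ℝ)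
    simpa [pow_succ, mul_comm] using this
  have hS : ∀ x, Summable fun m => (r m • g m) x := fun x => by
    refine Summable.of_norm_bounded hsum.summable fun m => ?_
    simpa only [norm_iteratedFDeriv_zero] using hbd m 0 (by norm_num) x
  have hnn : ∀ x m, 0 ≤ (r m • g m) x := fun x m => mul_nonneg (hr m).le (hg0 m x)
  refine ⟨fun x => ∑' m, (r m • g m) x, ?_, fun x => tsum_nonneg (hnn x), fun x => ?_, ?_, ?_⟩
  · refine contDiff_tsum (v := fun _ m => (1 / 2) ^ (m + 1)) (N := 2)
      (fun m => contDiff_const.smul (hg2 m)) (fun _ _ => hsum.summable) ?_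
    intro k m x hk
    exact hbd m k (by exact_mod_cast hk) x
  · rw [← hsum.tsum_eq]
    refine (hS x).tsum_le_tsum (fun m => ?_) hsum.summable
    have := hbd m 0 (by norm_num) x
    rw [norm_iteratedFDeriv_zero] at this
    exact (le_abs_self _).trans this
  · ext x
    simp only [Function.mem_support]
    constructor
    · intro hx
      by_contra hxΩ
      apply hx
      have : ∀ m, (r m • g m) x = 0 := fun m => by
        have : g m x = 0 := by
          by_contra h
          have : x ∈ Function.support (g m) := h
          rw [hg1] at this
          exact hxΩ this.1
        simp [this]
      simp [this]
    · intro hx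
      obtain ⟨m, hm⟩ := exists_nat_gt ‖x‖
      have h2 : x ∈ Function.support (g m) := by
        rw [hg1]; exact ⟨hx, by simpa using hm⟩
      have : 0 < (r m • g m) x := mul_pos (hr m) (lt_of_le_of_ne (hg0 m x) (Ne.symm h2))
      exact ((hS x).tsum_pos (hnn x) m this).ne'
  · have hl : ∀ m x y, |(r m • g m) x - (r m • g m) y| ≤ (1 / 2) ^ (m + 1) * ‖x - y‖ := by
      intro m x y
      have hd : ∀ z, DifferentiableAt ℝ (r m • g m) z := fun z =>
        ((hg2 m).differentiable (by norm_num) z).const_smul (r m)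
      refine Convex.norm_image_sub_le_of_norm_fderiv_le (𝕜 := ℝ) (s := Set.univ)
        (fun z _ => hd z) (fun z _ => ?_) convex_univ (Set.mem_univ y) (Set.mem_univ x)
      rw [← norm_iteratedFDeriv_one]
      exact hbd m 1 (by norm_num) z
    refine LipschitzWith.of_dist_le_mul fun x y => ?_
    rw [Real.dist_eq, ← (hS x).tsum_sub (hS y), dist_eq_norm]
    have hs2 : HasSum (fun m : ℕ => ((1 : ℝ) / 2) ^ (m + 1) * ‖x - y‖) (1 * ‖x - y‖) :=
      hsum.mul_right _
    have := tsum_of_norm_bounded hs2 (fun m => (Real.norm_eq_abs _).trans_le (hl m x y))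
    simpa using this

lemma integral_odd_symm {g : ℝ → ℝ} (hodd : ∀ x, g (-x) = -g x) (b : ℝ) :
    ∫ x in (-b)..b, g x = 0 := by
  have h := intervalIntegral.integral_comp_neg (a := -b) (b := b) g
  simp only [hodd, intervalIntegral.integral_neg, neg_neg] at h
  linarith

lemma integral_odd_nonneg {g : ℝ → ℝ} (hc : Continuous g) (hodd : ∀ x, g (-x) = -g x)
    (hg : ∀ x, 0 ≤ x → 0 ≤ g x) {a r : ℝ} (ha : 0 ≤ a) (hr : 0 ≤ r) :
    0 ≤ ∫ x in (a - r)..(a + r), g x := by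
  rcases le_total r a with h | h
  · exact intervalIntegral.integral_nonneg (by linarith) fun x hx => hg x (by linarith [hx.1])
  · have h1 := integral_odd_symm hodd (r - a)
    rw [show -(r - a) = a - r by ring] at h1
    rw [← intervalIntegral.integral_add_adjacent_intervals (b := r - a)
      (hc.intervalIntegrable _ _) (hc.intervalIntegrable _ _), h1, zero_add]
    exact intervalIntegral.integral_nonneg (by linarith) fun x hx => hg x (by linarith [hx.1])

lemma uniform_convolution_bound {h : ℝ → ℝ} (hc : Continuous h) (heven : ∀ x, h (-x) = h x)
    {C : ℝ} (hm : ∀ r, 0 ≤ r → ∫ u in (-1 : ℝ)..1, h (r * u) ≤ (r ^ 2 + C) / 2) (a : ℝ) :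
    ∀ r, 0 ≤ r → ∫ u in (-1 : ℝ)..1, ∫ v in (-1 : ℝ)..1, h (r * u + a * v) ≤
      r ^ 2 + a ^ 2 + C := by
  wlog ha : 0 ≤ a with H
  · intro r hr
    have := H hc heven hm (-a) (by linarith) r hr
    rw [neg_sq] at this
    refine le_of_eq_of_le ?_ this
    congr 1; ext u
    have := intervalIntegral.integral_comp_neg (a := -1) (b := 1) (fun v => h (r * u + a * v))
    simp only [neg_neg] at this
    rw [← this]
    congr 1; ext v; congr 1; ring
  intro r hr
  rcases hr.eq_or_lt with rfl | hr0
  · have := hm a ha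
    simp only [zero_mul, zero_add, intervalIntegral.integral_const]
    norm_num
    linarith
  rcases ha.eq_or_lt with rfl | ha0
  · have := hm r hr
    simp only [zero_mul, add_zero, intervalIntegral.integral_const]
    norm_num
    linarith
  let P : ℝ → ℝ := fun ρ => ∫ t in (0 : ℝ)..ρ, h t
  have hii : ∀ x y, IntervalIntegrable h volume x y := fun x y => hc.intervalIntegrable x y
  have hPc : Continuous P := intervalIntegral.continuous_primitive (fun x y => hii x y) 0
  have hPodd : ∀ x, P (-x) = -P x := by
    intro x
    have := intervalIntegral.integral_comp_neg (a := 0) (b := x) h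
    simp only [heven, neg_zero] at this
    simp only [P]
    rw [this, intervalIntegral.integral_symm]
  have hPsub : ∀ x y, ∫ t in x..y, h t = P y - P x := fun x y =>
    (intervalIntegral.integral_interval_sub_left (hii _ _) (hii _ _)).symm
  have hPb : ∀ ρ, 0 ≤ ρ → P ρ ≤ ρ * (ρ ^ 2 + C) / 4 := by
    intro ρ hρ
    rcases hρ.eq_or_lt with rfl | hρ0
    · simp [P]
    have h1 := hm ρ hρ
    rw [intervalIntegral.integral_comp_mul_left h hρ0.ne', smul_eq_mul, mul_neg, mul_one,
      hPsub, hPodd, inv_mul_le_iff₀ hρ0] at h1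
    linarith
  have hinner : ∀ x, ∫ v in (-1 : ℝ)..1, h (x + a * v) = a⁻¹ * (P (x + a) - P (x - a)) := by
    intro x
    rw [intervalIntegral.integral_comp_add_mul h ha0.ne', smul_eq_mul, hPsub]
    congr 3 <;> ring_nf
  simp only [hinner]
  have houter := intervalIntegral.integral_comp_mul_left (a := -1) (b := 1)
    (fun x => a⁻¹ * (P (x + a) - P (x - a))) hr0.ne'
  rw [houter, smul_eq_mul, intervalIntegral.integral_const_mul, mul_neg, mul_one,
    intervalIntegral.integral_sub (f := fun x => P (x + a)) (g := fun x => P (x - a))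
      ((hPc.comp (continuous_id.add continuous_const)).intervalIntegrable _ _)
      ((hPc.comp (continuous_id.sub continuous_const)).intervalIntegrable _ _),
    intervalIntegral.integral_comp_add_right P, intervalIntegral.integral_comp_sub_right P]
  have h2 : ∫ x in (-r - a)..(r - a), P x = - ∫ x in (a - r)..(a + r), P x := by
    have := intervalIntegral.integral_comp_neg (a := a - r) (b := a + r) P
    simp only [hPodd, intervalIntegral.integral_neg] at this
    rw [this]; congr 1 <;> ring
  rw [h2, show -r + a = a - r by ring, add_comm r a]
  have h3 : ∫ x in (a - r)..(a + r), (x * (x ^ 2 + C) / 4) = a * r * (r ^ 2 + a ^ 2 + C) / 2 := by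
    have : ∀ x : ℝ, x * (x ^ 2 + C) / 4 = (1 / 4) * x ^ 3 + (C / 4) * x := fun x => by ring
    simp only [this]
    rw [intervalIntegral.integral_add (Continuous.intervalIntegrable (by fun_prop) _ _)
        (Continuous.intervalIntegrable (by fun_prop) _ _),
      intervalIntegral.integral_const_mul, intervalIntegral.integral_const_mul, integral_pow,
      integral_id]
    push_cast; ring
  have h4 := integral_odd_nonneg (g := fun x => x * (x ^ 2 + C) / 4 - P x) (by fun_prop)
    (fun x => by simp only [hPodd]; ring) (fun x hx => by linarith [hPb x hx]) ha hr
  rw [intervalIntegral.integral_sub (by apply Continuous.intervalIntegrable; fun_prop)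
    (hPc.intervalIntegrable _ _), h3] at h4
  rw [inv_mul_le_iff₀ hr0, inv_mul_le_iff₀ ha0]
  linarith

lemma pi_uniform_bound (n : ℕ) : ∀ a : Fin n → ℝ,
    let μ : Measure (Fin n → ℝ) := Measure.pi fun _ => volume.restrict (Set.Ioo (-1 : ℝ) 1)
    Continuous (fun x : ℝ => ∫ y, |x + ∑ i, a i * y i| ∂μ) ∧
    (∀ x : ℝ, ∫ y, |-x + ∑ i, a i * y i| ∂μ = ∫ y, |x + ∑ i, a i * y i| ∂μ) ∧
    ∀ r : ℝ, 0 ≤ r → ∫ u in (-1 : ℝ)..1, ∫ y, |r * u + ∑ i, a i * y i| ∂μ ≤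
      2 ^ n * (r ^ 2 + ∑ i, a i ^ 2 + 1) / 2 := by
  induction n with
  | zero =>
    intro a
    have hone : (Measure.pi fun _ : Fin 0 => (volume : Measure ℝ).restrict
        (Set.Ioo (-1 : ℝ) 1)).real Set.univ = 1 := by
      simp [Measure.real]
    simp only [Finset.univ_eq_empty, Finset.sum_empty, add_zero, integral_const, hone, one_smul,
      abs_neg, pow_zero, one_mul]
    refine ⟨continuous_abs, fun _ => trivial, fun r hr => ?_⟩
    have h : ∫ u in (-1 : ℝ)..1, |r * u| = r := by
      have h0 : ∀ x y : ℝ, IntervalIntegrable (fun u : ℝ => |r * u|) volume x y := fun x y =>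
        Continuous.intervalIntegrable (by fun_prop) _ _
      rw [← intervalIntegral.integral_add_adjacent_intervals (h0 (-1) 0) (h0 0 1)]
      have h1 : ∫ u in (0 : ℝ)..1, |r * u| = r / 2 := by
        rw [intervalIntegral.integral_congr (g := fun u => r * u)]
        · rw [intervalIntegral.integral_const_mul, integral_id]; ring
        · intro u hu
          rw [Set.uIcc_of_le zero_le_one] at hu
          exact abs_of_nonneg (mul_nonneg hr hu.1)
      have h2 : ∫ u in (-1 : ℝ)..0, |r * u| = r / 2 := by
        rw [← h1]
        have := intervalIntegral.integral_comp_neg (a := 0) (b := 1) (fun u => |r * u|)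
        simp only [mul_neg, abs_neg, neg_zero] at this
        rw [this]
      rw [h1, h2]; ring
    rw [h]
    nlinarith [sq_nonneg (r - 1)]
  | succ n ih =>
    intro a μ
    set ν : Measure (Fin n → ℝ) := Measure.pi fun _ => volume.restrict (Set.Ioo (-1 : ℝ) 1)
      with hν
    obtain ⟨hc, he, hb⟩ := ih (fun i => a i.succ)
    set H : ℝ → ℝ := fun x => ∫ y, |x + ∑ i, a (Fin.succ i) * y i| ∂ν with hH
    have key : ∀ x : ℝ, ∫ y, |x + ∑ i, a i * y i| ∂μ = ∫ v in (-1 : ℝ)..1, H (x + a 0 * v) := by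
      intro x
      have hmp := (measurePreserving_piFinSuccAbove
        (fun _ : Fin (n + 1) => (volume : Measure ℝ).restrict (Set.Ioo (-1 : ℝ) 1)) 0)
      have h1 := hmp.integral_comp'
        (fun z : ℝ × (Fin n → ℝ) => |x + (a 0 * z.1 + ∑ i, a (Fin.succ i) * z.2 i)|)
      have h2 : ∫ y, |x + ∑ i, a i * y i| ∂μ = ∫ z : ℝ × (Fin n → ℝ),
          |x + (a 0 * z.1 + ∑ i, a (Fin.succ i) * z.2 i)|
            ∂((volume.restrict (Set.Ioo (-1 : ℝ) 1)).prod ν) := by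
        rw [← h1]
        refine integral_congr_ae (Eventually.of_forall fun y => ?_)
        simp only [Fin.sum_univ_succ]
        rfl
      rw [h2, integral_prod, intervalIntegral.integral_of_le (by norm_num),
        restrict_Ioo_eq_restrict_Ioc]
      · simp only [hH, add_assoc]
      · rw [hν, ← Measure.restrict_pi_pi, Measure.prod_restrict]
        refine IntegrableOn.mono_set (t := Set.Icc (-1) 1 ×ˢ Set.univ.pi fun _ => Set.Icc (-1) 1) ?_
          (Set.prod_mono Set.Ioo_subset_Icc_self (Set.pi_mono fun _ _ => Set.Ioo_subset_Icc_self))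
        refine ContinuousOn.integrableOn_compact
          (isCompact_Icc.prod (isCompact_univ_pi fun _ => isCompact_Icc)) ?_
        exact Continuous.continuousOn (by fun_prop)
    refine ⟨?_, ?_, ?_⟩
    · simp only [key]
      exact intervalIntegral.continuous_parametric_intervalIntegral_of_continuous'
        (f := fun x v => H (x + a 0 * v)) (by
          simp only [Function.uncurry_def]
          exact hc.comp (by fun_prop)) _ _
    · intro x
      simp only [key]
      have := intervalIntegral.integral_comp_neg (a := -1) (b := 1) (fun v => H (-x + a 0 * v))
      simp only [neg_neg] at this
      rw [← this]
      congr 1; ext v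
      have := he (x + a 0 * v)
      simp only [hH]
      rw [← this]
      ring_nf
    · intro r hr
      simp only [key]
      have hm : ∀ r : ℝ, 0 ≤ r → ∫ u in (-1 : ℝ)..1, (fun x => H x / 2 ^ n) (r * u) ≤
          (r ^ 2 + (∑ i : Fin n, a i.succ ^ 2 + 1)) / 2 := by
        intro r hr
        have := hb r hr
        rw [intervalIntegral.integral_div, div_le_iff₀ (by positivity)]
        calc _ ≤ _ := this
          _ = _ := by ring
      have h3 := uniform_convolution_bound (h := fun x => H x / 2 ^ n) (hc.div_const _)
        (fun x => by simp only [hH, he]) hm (a 0) r hr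
      simp only [intervalIntegral.integral_div] at h3
      rw [div_le_iff₀ (by positivity)] at h3
      refine h3.trans (le_of_eq ?_)
      rw [Fin.sum_univ_succ]
      ring

lemma pi_abs_sum_bound {n : ℕ} (a : Fin n → ℝ) :
    ∫ y in Set.univ.pi fun _ : Fin n => Set.Ioo (-1 : ℝ) 1, |∑ i, a i * y i| ≤
      2 ^ n * (∑ i, a i ^ 2 + 1) / 4 := by
  obtain ⟨-, -, h⟩ := pi_uniform_bound n a
  have := h 0 le_rfl
  simp only [zero_mul, zero_add, intervalIntegral.integral_const] at this
  rw [volume_pi, Measure.restrict_pi_pi]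
  norm_num at this
  linarith

/-- The centred cube of side length `ε`. -/
def stdCube (n : ℕ) (ε : ℝ) : Set (EuclideanSpace ℝ (Fin n)) := {y | ∀ i, |y i| < ε / 2}

lemma stdCube_two_eq (n : ℕ) : stdCube n 2 =
    (WithLp.ofLp : EuclideanSpace ℝ (Fin n) → (Fin n → ℝ)) ⁻¹'
      (Set.univ.pi fun _ : Fin n => Set.Ioo (-1 : ℝ) 1) := by
  ext y
  simp [stdCube, abs_lt]

lemma volume_stdCube_two (n : ℕ) : volume (stdCube n 2) = 2 ^ n := by
  have h := (EuclideanSpace.volume_preserving_symm_measurableEquiv_toLp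
    (Fin n)).measure_preimage_equiv (Set.univ.pi fun _ : Fin n => Set.Ioo (-1 : ℝ) 1)
  rw [Real.volume_pi_Ioo] at h
  rw [stdCube_two_eq]
  refine h.trans ?_
  norm_num

lemma abs_inner_stdCube_two_le {n : ℕ} (g : EuclideanSpace ℝ (Fin n)) :
    ∫ y in stdCube n 2, |⟪g, y⟫| ≤ 2 ^ n * (‖g‖ / 2) := by
  have key : ∀ g : EuclideanSpace ℝ (Fin n),
      ∫ y in stdCube n 2, |⟪g, y⟫| ≤ 2 ^ n * (‖g‖ ^ 2 + 1) / 4 := by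
    intro g
    have := pi_abs_sum_bound (fun i => g i)
    rw [EuclideanSpace.real_norm_sq_eq]
    refine le_of_eq_of_le ?_ this
    rw [stdCube_two_eq]
    have h := (EuclideanSpace.volume_preserving_symm_measurableEquiv_toLp
      (Fin n)).setIntegral_preimage_emb (MeasurableEquiv.measurableEmbedding _)
      (fun y : Fin n → ℝ => |∑ i, g i * y i|) (Set.univ.pi fun _ : Fin n => Set.Ioo (-1 : ℝ) 1)
    rw [← h]
    refine integral_congr_ae (Eventually.of_forall fun y => ?_)
    simp [PiLp.inner_apply, mul_comm]
  rcases eq_or_ne g 0 with rfl | hg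
  · simp
  have hg' : 0 < ‖g‖ := norm_pos_iff.2 hg
  have h1 := key (‖g‖⁻¹ • g)
  have h2 : ‖‖g‖⁻¹ • g‖ = 1 := norm_smul_inv_norm hg
  simp only [h2, inner_smul_left, abs_mul] at h1
  rw [integral_const_mul] at h1
  simp only [RCLike.conj_to_real, abs_inv, abs_norm, inv_mul_le_iff₀ hg'] at h1
  linarith

section Cubes

open scoped Pointwise

variable {n : ℕ} {ε : ℝ} {Q : Set (EuclideanSpace ℝ (Fin n))}

lemma isOpen_stdCube (n : ℕ) (ε : ℝ) : IsOpen (stdCube n ε) := by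
  simp only [stdCube, Set.ofPred_forall]
  exact isOpen_iInter_of_finite fun i => isOpen_lt (by fun_prop) continuous_const

lemma convex_stdCube (n : ℕ) (ε : ℝ) : Convex ℝ (stdCube n ε) := by
  have : stdCube n ε = ⋂ i, (EuclideanSpace.proj (𝕜 := ℝ) i : EuclideanSpace ℝ (Fin n) →L[ℝ] ℝ)
      ⁻¹' Metric.ball 0 (ε / 2) := by
    ext y; simp [stdCube]
  rw [this]
  exact convex_iInter fun i => (convex_ball (0 : ℝ) _).linear_preimage
    (EuclideanSpace.proj (𝕜 := ℝ) i : EuclideanSpace ℝ (Fin n) →L[ℝ] ℝ).toLinearMap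

lemma smul_stdCube_two (hε : 0 < ε) : (ε / 2) • stdCube n 2 = stdCube n ε := by
  ext y
  rw [Set.mem_smul_set_iff_inv_smul_mem₀ (by positivity)]
  simp only [stdCube, Set.mem_ofPred_eq, PiLp.smul_apply, smul_eq_mul, abs_mul, abs_inv,
    abs_of_pos (half_pos hε)]
  refine forall_congr' fun i => ?_
  rw [inv_mul_lt_iff₀ (by positivity)]
  norm_num

lemma IsCube.isOpen (hQ : IsCube n ε Q) : IsOpen Q := by
  obtain ⟨T, x, rfl⟩ := hQ
  exact (T.toHomeomorph.trans (Homeomorph.addLeft x)).isOpenMap _ (isOpen_stdCube n ε)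

lemma IsCube.convex (hQ : IsCube n ε Q) : Convex ℝ Q := by
  obtain ⟨T, x, rfl⟩ := hQ
  rw [show (fun y => x + T y) = (fun y => x + y) ∘ T from rfl, Set.image_comp]
  exact ((convex_stdCube n ε).linear_image T.toLinearEquiv.toLinearMap).translate x

lemma IsCube.dist_le (hε : 0 < ε) (hQ : IsCube n ε Q) {x y : EuclideanSpace ℝ (Fin n)}
    (hx : x ∈ Q) (hy : y ∈ Q) : ‖x - y‖ ≤ √n * ε := by
  obtain ⟨T, z, rfl⟩ := hQ
  obtain ⟨a, ha, rfl⟩ := hx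
  obtain ⟨b, hb, rfl⟩ := hy
  simp only [add_sub_add_left_eq_sub, ← map_sub, LinearIsometryEquiv.norm_map]
  rw [EuclideanSpace.norm_eq]
  have : ∑ i, ‖(a - b) i‖ ^ 2 ≤ n * ε ^ 2 := by
    calc ∑ i, ‖(a - b) i‖ ^ 2 ≤ ∑ _i : Fin n, ε ^ 2 := by
          refine Finset.sum_le_sum fun i _ => ?_
          refine pow_le_pow_left₀ (norm_nonneg _) ?_ 2
          have h1 := abs_lt.1 (ha i)
          have h2 := abs_lt.1 (hb i)
          simp only [PiLp.sub_apply, Real.norm_eq_abs]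
          exact abs_le.2 ⟨by linarith, by linarith⟩
      _ = n * ε ^ 2 := by simp
  calc _ ≤ √(n * ε ^ 2) := Real.sqrt_le_sqrt this
    _ = √n * ε := by rw [Real.sqrt_mul (by positivity), Real.sqrt_sq hε.le]

lemma IsCube.exists_center (hε : 0 < ε) (hQ : IsCube n ε Q) : Q.Nonempty := by
  obtain ⟨T, z, rfl⟩ := hQ
  exact ⟨_, ⟨0, by simp [hε], rfl⟩⟩

lemma cube_setIntegral (hε : 0 < ε)
    (T : EuclideanSpace ℝ (Fin n) ≃ₗᵢ[ℝ] EuclideanSpace ℝ (Fin n))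
    (x : EuclideanSpace ℝ (Fin n)) (h : EuclideanSpace ℝ (Fin n) → ℝ) :
    ∫ y in (fun y => x + T y) '' stdCube n ε, h y =
      (ε / 2) ^ n * ∫ y in stdCube n 2, h (x + (ε / 2) • T y) := by
  have hmp : MeasurePreserving (fun y => x + T y) volume volume :=
    (measurePreserving_add_left volume x).comp T.measurePreserving
  have hemb : MeasurableEmbedding (fun y => x + T y) :=
    (T.toHomeomorph.trans (Homeomorph.addLeft x)).measurableEmbedding
  rw [hmp.setIntegral_image_emb hemb]
  have h2 := Measure.setIntegral_comp_smul_of_pos (volume : Measure (EuclideanSpace ℝ (Fin n)))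
    (fun y => h (x + T y)) (stdCube n 2) (half_pos hε)
  rw [smul_stdCube_two hε] at h2
  simp only [map_smul] at h2
  rw [h2]
  simp only [finrank_euclideanSpace, Fintype.card_fin, smul_eq_mul]
  rw [← mul_assoc, mul_inv_cancel₀ (by positivity), one_mul]

lemma IsCube.volume_eq (hε : 0 < ε) (hQ : IsCube n ε Q) : volume Q = ENNReal.ofReal (ε ^ n) := by
  obtain ⟨T, x, rfl⟩ := hQ
  have hmp : MeasurePreserving (fun y => x + T y) volume volume :=
    (measurePreserving_add_left volume x).comp T.measurePreserving
  have hemb : MeasurableEmbedding (fun y => x + T y) :=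
    (T.toHomeomorph.trans (Homeomorph.addLeft x)).measurableEmbedding
  change volume ((fun y => x + T y) '' stdCube n ε) = _
  have := hmp.measure_preimage_emb hemb ((fun y => x + T y) '' stdCube n ε)
  rw [Set.preimage_image_eq _ hemb.injective] at this
  rw [← this, ← smul_stdCube_two hε, Measure.addHaar_smul_of_nonneg _ (half_pos hε).le,
    volume_stdCube_two, finrank_euclideanSpace, Fintype.card_fin,
    show (2 : ℝ≥0∞) ^ n = ENNReal.ofReal (2 ^ n) by
      rw [ENNReal.ofReal_pow (by norm_num)]; norm_num,
    ← ENNReal.ofReal_mul (by positivity), ← mul_pow]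
  norm_num

lemma IsCube.measureReal_eq (hε : 0 < ε) (hQ : IsCube n ε Q) : volume.real Q = ε ^ n := by
  rw [Measure.real, hQ.volume_eq hε, ENNReal.toReal_ofReal (by positivity)]

lemma integral_inner_stdCube (g : EuclideanSpace ℝ (Fin n)) (r : ℝ) :
    ∫ y in stdCube n r, ⟪g, y⟫ = 0 := by
  have h1 : ∫ y in stdCube n r, ⟪g, y⟫ = ∫ y in stdCube n r, ⟪g, -y⟫ := by
    have := (Measure.measurePreserving_neg
      (volume : Measure (EuclideanSpace ℝ (Fin n)))).setIntegral_preimage_emb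
      (Homeomorph.neg _).measurableEmbedding (fun y => ⟪g, y⟫) (stdCube n r)
    rw [← this]
    congr 2
    ext y
    simp [stdCube]
  simp only [inner_neg_right, integral_neg] at h1
  linarith

lemma IsCube.inner_oscillation_le (hε : 0 < ε) (hQ : IsCube n ε Q)
    (g : EuclideanSpace ℝ (Fin n)) :
    ⨍ x in Q, |⟪g, x⟫ - ⨍ y in Q, ⟪g, y⟫| ≤ ε * ‖g‖ / 4 := by
  have hvol := hQ.measureReal_eq hε
  obtain ⟨T, x, rfl⟩ := hQ
  change volume.real ((fun y => x + T y) '' stdCube n ε) = _ at hvol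
  change ⨍ z in (fun y => x + T y) '' stdCube n ε,
    |⟪g, z⟫ - ⨍ y in (fun y => x + T y) '' stdCube n ε, ⟪g, y⟫| ≤ ε * ‖g‖ / 4
  have hadj : ∀ y, ⟪g, T y⟫ = ⟪T.symm g, y⟫ := fun y => by
    rw [← T.inner_map_map (T.symm g) y, T.apply_symm_apply]
  have hint : IntegrableOn (fun y : EuclideanSpace ℝ (Fin n) => ⟪T.symm g, y⟫) (stdCube n 2) := by
    refine IntegrableOn.mono_set (t := closedBall 0 (√n * 2)) ?_ ?_
    · exact ContinuousOn.integrableOn_compact (isCompact_closedBall _ _)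
        (Continuous.continuousOn (by fun_prop))
    · intro y hy
      have hc : IsCube n 2 (stdCube n 2) := ⟨LinearIsometryEquiv.refl ℝ _, 0, by simp [stdCube]⟩
      have h0 : (0 : EuclideanSpace ℝ (Fin n)) ∈ stdCube n 2 := by simp [stdCube]
      have := hc.dist_le two_pos hy h0
      simpa using this
  have hvr : volume.real (stdCube n 2) = 2 ^ n := by
    rw [Measure.real, volume_stdCube_two]; simp
  have hp : ((ε : ℝ) / 2) ^ n * 2 ^ n = ε ^ n := by rw [← mul_pow]; norm_num
  have havg : ⨍ y in (fun y => x + T y) '' stdCube n ε, ⟪g, y⟫ = ⟪g, x⟫ := by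
    rw [setAverage_eq, hvol, cube_setIntegral hε]
    simp only [inner_add_right, inner_smul_right, hadj]
    rw [integral_add (integrable_const_iff.2 (Or.inr ?_)) (hint.const_mul _),
      integral_const_mul, integral_inner_stdCube, setIntegral_const, hvr]
    · simp only [mul_zero, add_zero, smul_eq_mul]
      rw [← mul_assoc, ← mul_assoc, mul_assoc _ _ (2 ^ n : ℝ), hp, inv_mul_cancel₀ (by positivity),
        one_mul]
    · exact ⟨by simp [volume_stdCube_two]⟩
  rw [havg, setAverage_eq, hvol, cube_setIntegral hε]
  simp only [inner_add_right, inner_smul_right, hadj, add_sub_cancel_left, abs_mul,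
    abs_of_pos (half_pos hε)]
  rw [integral_const_mul, smul_eq_mul, inv_mul_le_iff₀ (by positivity)]
  have h := abs_inner_stdCube_two_le (T.symm g)
  rw [LinearIsometryEquiv.norm_map] at h
  calc _ ≤ (ε / 2) ^ n * (ε / 2 * (2 ^ n * (‖g‖ / 2))) := by gcongr
    _ = (ε / 2) ^ n * 2 ^ n * (ε * ‖g‖ / 4) := by ring
    _ = _ := by rw [hp]

end Cubes

section MeanOscillation

variable {α : Type*} [MeasurableSpace α]

/-- The double-integral mean oscillation of `u` with respect to `P`. -/
def doubleOsc (P : Measure α) (u : α → ℝ) : ℝ≥0∞ := ∫⁻ x, ∫⁻ y, ‖u x - u y‖ₑ ∂P ∂P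

lemma aemeasurable_doubleOsc_inner {P : Measure α} [SFinite P] {u : α → ℝ}
    (hu : AEStronglyMeasurable u P) : AEMeasurable (fun x => ∫⁻ y, ‖u x - u y‖ₑ ∂P) P := by
  have : AEMeasurable (fun z : α × α => ‖u z.1 - u z.2‖ₑ) (P.prod P) :=
    (hu.comp_fst.sub hu.comp_snd).enorm
  exact this.lintegral_prod_right'

lemma doubleOsc_add_le {P : Measure α} [SFinite P] {u v : α → ℝ}
    (hu : AEStronglyMeasurable u P) :
    doubleOsc P (fun x => u x + v x) ≤ doubleOsc P u + doubleOsc P v := by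
  unfold doubleOsc
  rw [← lintegral_add_left' (aemeasurable_doubleOsc_inner hu)]
  refine lintegral_mono fun x => ?_
  dsimp only
  have hm : AEMeasurable (fun y => ‖u x - u y‖ₑ) P :=
    (aestronglyMeasurable_const.sub hu).enorm
  rw [← lintegral_add_left' hm]
  refine lintegral_mono fun y => ?_
  dsimp only
  rw [add_sub_add_comm]
  exact enorm_add_le _ _

lemma doubleOsc_le_liminf {P : Measure α} [SFinite P] {u : ℕ → α → ℝ} {v : α → ℝ}
    (hu : ∀ j, AEStronglyMeasurable (u j) P)
    (h : ∀ᵐ x ∂P, Tendsto (fun j => u j x) atTop (𝓝 (v x))) :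
    doubleOsc P v ≤ liminf (fun j => doubleOsc P (u j)) atTop := by
  unfold doubleOsc
  refine le_trans ?_ (lintegral_liminf_le' fun j => aemeasurable_doubleOsc_inner (hu j))
  refine lintegral_mono_ae ?_
  filter_upwards [h] with x hx
  refine le_trans ?_ (lintegral_liminf_le' fun j =>
    (aestronglyMeasurable_const.sub (hu j)).enorm)
  refine lintegral_mono_ae ?_
  filter_upwards [h] with y hy
  exact (hx.sub hy).enorm.liminf_eq.ge

lemma ofReal_integral_abs_sub_le_doubleOsc {P : Measure α} [IsProbabilityMeasure P] {v : α → ℝ}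
    (hv : Integrable v P) : ENNReal.ofReal (∫ x, |v x - ∫ y, v y ∂P| ∂P) ≤ doubleOsc P v := by
  have h1 : Integrable (fun x => v x - ∫ y, v y ∂P) P := hv.sub (integrable_const _)
  have h2 := ofReal_integral_norm_eq_lintegral_enorm h1
  simp only [Real.norm_eq_abs] at h2
  rw [h2]
  refine lintegral_mono fun x => ?_
  have h3 : v x - ∫ y, v y ∂P = ∫ y, (v x - v y) ∂P := by
    rw [integral_sub (integrable_const _) hv]; simp
  rw [h3]
  exact enorm_integral_le_lintegral_enorm _

lemma ofReal_integral_abs_add_le {P : Measure α} [IsProbabilityMeasure P] {l v : α → ℝ}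
    (hl : Integrable l P) (hv : AEStronglyMeasurable v P) :
    ENNReal.ofReal (∫ x, |l x + v x - ∫ y, (l y + v y) ∂P| ∂P) ≤
      ENNReal.ofReal (∫ x, |l x - ∫ y, l y ∂P| ∂P) + doubleOsc P v := by
  by_cases hvi : Integrable v P
  · refine le_trans ?_ (add_le_add_right (ofReal_integral_abs_sub_le_doubleOsc hvi) _)
    rw [← ENNReal.ofReal_add (by positivity) (by positivity)]
    refine ENNReal.ofReal_le_ofReal ?_
    have h1 : Integrable (fun x => |l x - ∫ y, l y ∂P|) P := (hl.sub (integrable_const _)).abs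
    have h2 : Integrable (fun x => |v x - ∫ y, v y ∂P|) P := (hvi.sub (integrable_const _)).abs
    rw [← integral_add h1 h2, integral_add hl hvi]
    refine integral_mono ((hl.add hvi).sub (integrable_const _)).abs (h1.add h2) fun x => ?_
    dsimp only
    rw [add_sub_add_comm]
    exact abs_add_le _ _
  · have hw : ¬ Integrable (fun x => l x + v x) P := by
      intro h
      apply hvi
      refine (h.sub hl).congr (Eventually.of_forall fun x => ?_)
      simp
    have h0 : ¬ Integrable (fun x => |l x + v x|) P := by
      intro h
      exact hw ((integrable_norm_iff (hl.aestronglyMeasurable.add hv)).1 h)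
    rw [integral_undef hw]
    simp only [sub_zero]
    rw [integral_undef h0]
    simp

end MeanOscillation

section Poincare

variable {n : ℕ}

lemma lintegral_comp_smul_add {G : EuclideanSpace ℝ (Fin n) → ℝ≥0∞} (hG : Measurable G)
    {c : ℝ} (hc : 1 / 2 ≤ c) (b : EuclideanSpace ℝ (Fin n)) :
    ∫⁻ x, G (c • x + b) ≤ 2 ^ n * ∫⁻ x, G x := by
  have hc0 : 0 < c := by linarith
  have h1 : ∫⁻ x, G (c • x + b) = ∫⁻ x, G (x + b) ∂(Measure.map (c • ·) volume) := by
    have hm : Measurable fun x : EuclideanSpace ℝ (Fin n) => G (x + b) :=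
      hG.comp (measurable_id.add_const b)
    exact (lintegral_map hm (measurable_const_smul c)).symm
  rw [h1, Measure.map_addHaar_smul _ hc0.ne', lintegral_smul_measure, lintegral_add_right_eq_self G,
    finrank_euclideanSpace, Fintype.card_fin, smul_eq_mul]
  gcongr
  rw [show (2 : ℝ≥0∞) ^ n = ENNReal.ofReal (2 ^ n) by
      rw [ENNReal.ofReal_pow (by norm_num)]; norm_num]
  refine ENNReal.ofReal_le_ofReal ?_
  rw [abs_of_pos (by positivity), ← inv_pow]
  refine pow_le_pow_left₀ (by positivity) ?_ n
  rw [inv_le_comm₀ hc0 two_pos]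
  linarith

lemma enorm_sub_le_lintegral_segment {u : EuclideanSpace ℝ (Fin n) → ℝ}
    {Q : Set (EuclideanSpace ℝ (Fin n))} (hQo : IsOpen Q) (hQc : Convex ℝ Q)
    (hu : ContDiffOn ℝ 1 u Q) {d : ℝ} {x y : EuclideanSpace ℝ (Fin n)} (hx : x ∈ Q) (hy : y ∈ Q)
    (hd : ‖y - x‖ ≤ d) :
    ‖u x - u y‖ₑ ≤ ∫⁻ t in Set.Icc (0 : ℝ) 1,
      ENNReal.ofReal d * Q.indicator (fun z => ‖fderiv ℝ u z‖ₑ) (x + t • (y - x)) := by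
  have hmem : ∀ t ∈ Set.Icc (0 : ℝ) 1, x + t • (y - x) ∈ Q := fun t ht =>
    hQc.add_smul_sub_mem hx hy ht
  have hcd : ContDiffOn ℝ 1 (fun t : ℝ => u (x + t • (y - x))) (Set.Icc 0 1) :=
    hu.comp (by fun_prop) hmem
  have h := enorm_sub_le_lintegral_deriv_of_contDiffOn_Icc hcd zero_le_one
  simp only [one_smul, zero_smul, add_zero, add_sub_cancel] at h
  rw [enorm_sub_rev]
  refine h.trans (setLIntegral_mono' measurableSet_Icc fun t ht => ?_)
  rw [Set.indicator_of_mem (hmem t ht)]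
  have hdiff : DifferentiableAt ℝ u (x + t • (y - x)) :=
    (hu.differentiableOn (by norm_num)).differentiableAt (hQo.mem_nhds (hmem t ht))
  have hl : HasDerivAt (fun t : ℝ => x + t • (y - x)) (y - x) t := by
    simpa using ((hasDerivAt_id t).smul_const (y - x)).const_add x
  have : HasDerivAt (fun t : ℝ => u (x + t • (y - x)))
      (fderiv ℝ u (x + t • (y - x)) (y - x)) t := hdiff.hasFDerivAt.comp_hasDerivAt t hl
  rw [this.deriv]
  refine (ContinuousLinearMap.le_opENorm _ _).trans ?_
  rw [mul_comm]
  gcongr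
  rw [← ofReal_norm]
  exact ENNReal.ofReal_le_ofReal hd

lemma poincare_double {u : EuclideanSpace ℝ (Fin n) → ℝ}
    {Q : Set (EuclideanSpace ℝ (Fin n))} (hQo : IsOpen Q) (hQc : Convex ℝ Q)
    (hu : ContDiffOn ℝ 1 u Q) {d : ℝ} (hd : ∀ x ∈ Q, ∀ y ∈ Q, ‖y - x‖ ≤ d) :
    doubleOsc (volume.restrict Q) u ≤
      ENNReal.ofReal d * (2 ^ n * volume Q * ∫⁻ x in Q, ‖fderiv ℝ u x‖ₑ) := by
  set G : EuclideanSpace ℝ (Fin n) → ℝ≥0∞ := Q.indicator (fun z => ‖fderiv ℝ u z‖ₑ) with hGdef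
  have hG : Measurable G := (measurable_fderiv ℝ u).enorm.indicator hQo.measurableSet
  have hGint : ∫⁻ x, G x = ∫⁻ x in Q, ‖fderiv ℝ u x‖ₑ := lintegral_indicator hQo.measurableSet _
  set A := ∫⁻ x in Q, ‖fderiv ℝ u x‖ₑ with hA
  have hmeas3 : Measurable (fun z : (EuclideanSpace ℝ (Fin n) × EuclideanSpace ℝ (Fin n)) × ℝ =>
      G (z.1.1 + z.2 • (z.1.2 - z.1.1))) := hG.comp (by fun_prop)
  have h1 : doubleOsc (volume.restrict Q) u ≤ ENNReal.ofReal d *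
      ∫⁻ x in Q, ∫⁻ y in Q, ∫⁻ t in Set.Icc (0 : ℝ) 1, G (x + t • (y - x)) := by
    unfold doubleOsc
    have hm1 : Measurable (fun z : EuclideanSpace ℝ (Fin n) × EuclideanSpace ℝ (Fin n) =>
        ∫⁻ t in Set.Icc (0 : ℝ) 1, G (z.1 + t • (z.2 - z.1))) := hmeas3.lintegral_prod_right'
    rw [← lintegral_const_mul _ hm1.lintegral_prod_right']
    refine setLIntegral_mono' hQo.measurableSet fun x hx => ?_
    have hm2 : Measurable fun y => ∫⁻ t in Set.Icc (0 : ℝ) 1, G (x + t • (y - x)) :=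
      hm1.comp measurable_prodMk_left
    rw [← lintegral_const_mul _ hm2]
    refine setLIntegral_mono' hQo.measurableSet fun y hy => ?_
    have hm4 : Measurable fun t : ℝ => G (x + t • (y - x)) := hG.comp (by fun_prop)
    rw [← lintegral_const_mul _ hm4]
    exact enorm_sub_le_lintegral_segment hQo hQc hu hx hy (hd x hx y hy)
  refine h1.trans ?_
  gcongr
  have h2 : ∫⁻ x in Q, ∫⁻ y in Q, ∫⁻ t in Set.Icc (0 : ℝ) 1, G (x + t • (y - x)) =
      ∫⁻ t in Set.Icc (0 : ℝ) 1, ∫⁻ x in Q, ∫⁻ y in Q, G (x + t • (y - x)) := by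
    have : ∀ x, ∫⁻ y in Q, ∫⁻ t in Set.Icc (0 : ℝ) 1, G (x + t • (y - x)) =
        ∫⁻ t in Set.Icc (0 : ℝ) 1, ∫⁻ y in Q, G (x + t • (y - x)) := fun x =>
      lintegral_lintegral_swap (f := fun y t => G (x + t • (y - x)))
        (Measurable.aemeasurable (hG.comp (by fun_prop)))
    simp only [this]
    refine lintegral_lintegral_swap (f := fun x t => ∫⁻ y in Q, G (x + t • (y - x))) ?_
    have : Measurable fun z : (EuclideanSpace ℝ (Fin n) × ℝ) × EuclideanSpace ℝ (Fin n) =>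
        G (z.1.1 + z.1.2 • (z.2 - z.1.1)) := hG.comp (by fun_prop)
    exact this.lintegral_prod_right'.aemeasurable
  rw [h2]
  have h3 : ∀ t ∈ Set.Icc (0 : ℝ) 1,
      ∫⁻ x in Q, ∫⁻ y in Q, G (x + t • (y - x)) ≤ 2 ^ n * volume Q * A := by
    intro t ht
    rcases le_total t (1 / 2) with h | h
    · rw [lintegral_lintegral_swap (f := fun x y => G (x + t • (y - x)))
        (Measurable.aemeasurable (hG.comp (by fun_prop)))]
      calc ∫⁻ y in Q, ∫⁻ x in Q, G (x + t • (y - x)) ≤ ∫⁻ _y in Q, 2 ^ n * A := by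
            refine lintegral_mono fun y => ?_
            refine (setLIntegral_le_lintegral _ _).trans ?_
            have := lintegral_comp_smul_add hG (c := 1 - t) (by linarith) (t • y)
            rw [hGint] at this
            refine le_of_eq_of_le ?_ this
            congr 1; ext x; congr 1; module
        _ = 2 ^ n * volume Q * A := by rw [setLIntegral_const]; ring
    · calc ∫⁻ x in Q, ∫⁻ y in Q, G (x + t • (y - x)) ≤ ∫⁻ _y in Q, 2 ^ n * A := by
            refine lintegral_mono fun x => ?_
            refine (setLIntegral_le_lintegral _ _).trans ?_
            have := lintegral_comp_smul_add hG (c := t) h ((1 - t) • x)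
            rw [hGint] at this
            refine le_of_eq_of_le ?_ this
            congr 1; ext y; congr 1; module
        _ = 2 ^ n * volume Q * A := by rw [setLIntegral_const]; ring
  calc _ ≤ ∫⁻ _t in Set.Icc (0 : ℝ) 1, 2 ^ n * volume Q * A :=
        setLIntegral_mono' measurableSet_Icc h3
    _ = _ := by rw [setLIntegral_const, Real.volume_Icc]; simp

end Poincare

section Divergence

variable {n : ℕ} {Ω : Set (EuclideanSpace ℝ (Fin n))}

lemma integrable_of_continuousOn_of_eq_zero {F : Type*} [NormedAddCommGroup F]
    {g : EuclideanSpace ℝ (Fin n) → F}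
    {K : Set (EuclideanSpace ℝ (Fin n))} (hK : IsCompact K) (hg : ContinuousOn g K)
    (h0 : ∀ x ∉ K, g x = 0) : Integrable g :=
  (integrableOn_iff_integrable_of_support_subset
    (fun x hx => by by_contra h; exact hx (h0 x h))).1 (hg.integrableOn_compact hK)

lemma integral_fderiv_apply_eq_zero {w : EuclideanSpace ℝ (Fin n) → ℝ} (hw : ContDiff ℝ 1 w)
    (hc : HasCompactSupport w) (v : EuclideanSpace ℝ (Fin n)) : ∫ x, fderiv ℝ w x v = 0 := by
  have hi : Integrable (fun x => fderiv ℝ w x v) :=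
    Continuous.integrable_of_hasCompactSupport
      ((hw.continuous_fderiv (by norm_num)).clm_apply continuous_const) (hc.fderiv_apply ℝ v)
  have hi2 : Integrable w := hw.continuous.integrable_of_hasCompactSupport hc
  have := integral_mul_fderiv_eq_neg_fderiv_mul_of_integrable (μ := volume)
    (f := fun _ : EuclideanSpace ℝ (Fin n) => (1 : ℝ)) (g := w) (v := v)
    (by simp) (by simpa using hi) (by simpa using hi2) (by fun_prop)
    (fun x _ => hw.differentiable (by norm_num) x)
  simpa using this

lemma vdiv_eq_zero_of_notMem {Φ : EuclideanSpace ℝ (Fin n) → EuclideanSpace ℝ (Fin n)}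
    {x : EuclideanSpace ℝ (Fin n)} (hx : x ∉ tsupport Φ) : vdiv n Φ x = 0 := by
  have : fderiv ℝ Φ x = 0 := by
    by_contra h
    exact hx (support_fderiv_subset ℝ h)
  simp [vdiv, this]

lemma continuous_vdiv {Φ : EuclideanSpace ℝ (Fin n) → EuclideanSpace ℝ (Fin n)}
    (hΦ : ContDiff ℝ 1 Φ) : Continuous (vdiv n Φ) := by
  unfold vdiv
  refine continuous_finsetSum _ fun i _ => ?_
  have h : Continuous fun x => fderiv ℝ Φ x (EuclideanSpace.single i 1) :=
    (hΦ.continuous_fderiv (by norm_num)).clm_apply continuous_const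
  exact (PiLp.continuous_apply 2 _ i).comp h

lemma integral_vdiv_eq_zero {Φ : EuclideanSpace ℝ (Fin n) → EuclideanSpace ℝ (Fin n)}
    (hΦ : ContDiff ℝ 1 Φ) (hc : HasCompactSupport Φ) : ∫ x, vdiv n Φ x = 0 := by
  have hcomp : ∀ i : Fin n, ContDiff ℝ 1 fun x => Φ x i := fun i =>
    (EuclideanSpace.proj (𝕜 := ℝ) i).contDiff.comp hΦ
  have hcc : ∀ i : Fin n, HasCompactSupport fun x => Φ x i := fun i =>
    hc.comp_left (g := fun y : EuclideanSpace ℝ (Fin n) => y i) (by simp)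
  have hd : ∀ (i : Fin n) x v, fderiv ℝ (fun x => Φ x i) x v = fderiv ℝ Φ x v i := fun i x v => by
    have h := (EuclideanSpace.proj (𝕜 := ℝ) i).hasFDerivAt.comp x
      (hΦ.differentiable (by norm_num) x).hasFDerivAt
    have h2 : HasFDerivAt (fun x => Φ x i) _ x := h
    rw [h2.fderiv]; rfl
  unfold vdiv
  rw [integral_finsetSum]
  · refine Finset.sum_eq_zero fun i _ => ?_
    simp only [← hd]
    exact integral_fderiv_apply_eq_zero (hcomp i) (hcc i) _
  · intro i _
    simp only [← hd]
    exact Continuous.integrable_of_hasCompactSupport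
      (((hcomp i).continuous_fderiv (by norm_num)).clm_apply continuous_const)
      ((hcc i).fderiv_apply ℝ _)

lemma sum_clm_single (l : EuclideanSpace ℝ (Fin n) →L[ℝ] ℝ) (v : EuclideanSpace ℝ (Fin n)) :
    ∑ i, l (EuclideanSpace.single i 1) * v i = l v := by
  conv_rhs => rw [← (EuclideanSpace.basisFun (Fin n) ℝ).sum_repr v, map_sum]
  refine Finset.sum_congr rfl fun i _ => ?_
  simp [mul_comm]

lemma vdiv_smul {a : EuclideanSpace ℝ (Fin n) → ℝ}
    {Φ : EuclideanSpace ℝ (Fin n) → EuclideanSpace ℝ (Fin n)} {x : EuclideanSpace ℝ (Fin n)}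
    (ha : DifferentiableAt ℝ a x) (hΦ : DifferentiableAt ℝ Φ x) :
    vdiv n (fun y => a y • Φ y) x = a x * vdiv n Φ x + fderiv ℝ a x (Φ x) := by
  have h : fderiv ℝ (fun y => a y • Φ y) x = _ := (ha.hasFDerivAt.smul hΦ.hasFDerivAt).fderiv
  rw [← sum_clm_single (fderiv ℝ a x)]
  simp only [vdiv, h, Finset.mul_sum, ← Finset.sum_add_distrib]
  refine Finset.sum_congr rfl fun i _ => ?_
  simp

lemma contDiff_of_contDiffAt_tsupport {E F : Type*} [NormedAddCommGroup E] [NormedSpace ℝ E]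
    [NormedAddCommGroup F] [NormedSpace ℝ F] {m : WithTop ℕ∞} {w : E → F} {K : Set E}
    (hK : IsClosed K) (h0 : ∀ x ∉ K, w x = 0) (h : ∀ x ∈ K, ContDiffAt ℝ m w x) :
    ContDiff ℝ m w := by
  refine contDiff_iff_contDiffAt.2 fun x => ?_
  by_cases hx : x ∈ K
  · exact h x hx
  · refine (contDiffAt_const (c := (0 : F))).congr_of_eventuallyEq ?_
    filter_upwards [hK.isOpen_compl.mem_nhds hx] with y hy using h0 y hy

/-- Integration by parts on an open set against a compactly supported vector field. -/
lemma setIntegral_mul_vdiv {u : EuclideanSpace ℝ (Fin n) → ℝ} (hΩ : IsOpen Ω)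
    (hu : ContDiffOn ℝ 1 u Ω) {Φ : EuclideanSpace ℝ (Fin n) → EuclideanSpace ℝ (Fin n)}
    (hΦ : ContDiff ℝ 1 Φ) (hc : HasCompactSupport Φ) (hs : tsupport Φ ⊆ Ω) :
    ∫ x in Ω, u x * vdiv n Φ x = - ∫ x in Ω, fderiv ℝ u x (Φ x) := by
  have hda : ∀ x ∈ Ω, ContDiffAt ℝ 1 u x := fun x hx => hu.contDiffAt (hΩ.mem_nhds hx)
  have hsub : tsupport (fun x => u x • Φ x) ⊆ tsupport Φ :=
    closure_mono fun x hx h => hx (by simp [h])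
  have hW : ContDiff ℝ 1 (fun x => u x • Φ x) := by
    refine contDiff_of_contDiffAt_tsupport (isClosed_tsupport Φ) (fun x hx => ?_) fun x hx => ?_
    · rw [image_eq_zero_of_notMem_tsupport hx, smul_zero]
    · exact ContDiffAt.smul (hda x (hs hx)) hΦ.contDiffAt
  have hWc : HasCompactSupport (fun x => u x • Φ x) :=
    HasCompactSupport.of_support_subset_isCompact hc (subset_closure.trans hsub)
  have h0 := integral_vdiv_eq_zero hW hWc
  have hpt : ∀ x, vdiv n (fun x => u x • Φ x) x = u x * vdiv n Φ x + fderiv ℝ u x (Φ x) := by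
    intro x
    by_cases hx : x ∈ tsupport Φ
    · exact vdiv_smul ((hda x (hs hx)).differentiableAt (by norm_num))
        (hΦ.differentiable (by norm_num) x)
    · rw [vdiv_eq_zero_of_notMem hx, vdiv_eq_zero_of_notMem (fun h => hx (hsub h)),
        image_eq_zero_of_notMem_tsupport hx]
      simp
  have hi1 : Integrable (fun x => u x * vdiv n Φ x) :=
    integrable_of_continuousOn_of_eq_zero (K := tsupport Φ) hc
      ((hu.continuousOn.mono hs).mul (continuous_vdiv hΦ).continuousOn)
      (fun x hx => by rw [vdiv_eq_zero_of_notMem hx, mul_zero])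
  have hi2 : Integrable (fun x => fderiv ℝ u x (Φ x)) :=
    integrable_of_continuousOn_of_eq_zero (K := tsupport Φ) hc
      (((hu.continuousOn_fderiv_of_isOpen hΩ le_rfl).mono hs).clm_apply hΦ.continuous.continuousOn)
      (fun x hx => by rw [image_eq_zero_of_notMem_tsupport hx, map_zero])
  simp only [hpt] at h0
  rw [integral_add hi1 hi2] at h0
  rw [setIntegral_eq_integral_of_forall_compl_eq_zero, setIntegral_eq_integral_of_forall_compl_eq_zero]
  · linarith
  · intro x hx
    rw [image_eq_zero_of_notMem_tsupport (fun h => hx (hs h)), map_zero]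
  · intro x hx
    rw [vdiv_eq_zero_of_notMem (fun h => hx (hs h)), mul_zero]

end Divergence

section Exhaustion

variable {n : ℕ} {Ω : Set (EuclideanSpace ℝ (Fin n))}

lemma exists_compact_exhaustion (hΩ : IsOpen Ω) :
    ∃ K : ℕ → Set (EuclideanSpace ℝ (Fin n)), (∀ m, IsCompact (K m)) ∧ Monotone K ∧
      (∀ m, K m ⊆ Ω) ∧ (⋃ m, K m) = Ω ∧
      ∀ K', IsCompact K' → K' ⊆ Ω → ∃ m, K' ⊆ K m := by
  obtain ⟨η, hη, hη0, -, hηs, -⟩ := exists_smooth_dist hΩ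
  have hsub : ∀ m : ℕ, {x | 1 / ((m : ℝ) + 1) ≤ η x} ∩ closedBall 0 m ⊆ Ω := by
    intro m x hx
    rw [← hηs]
    have : 0 < 1 / ((m : ℝ) + 1) := by positivity
    exact (this.trans_le hx.1).ne'
  have hex : ∀ K', IsCompact K' → K' ⊆ Ω →
      ∃ m : ℕ, K' ⊆ {x | 1 / ((m : ℝ) + 1) ≤ η x} ∩ closedBall 0 m := by
    intro K' hK' hK'Ω
    rcases K'.eq_empty_or_nonempty with rfl | hne
    · exact ⟨0, Set.empty_subset _⟩
    obtain ⟨x0, hx0, hmin⟩ := hK'.exists_isMinOn hne hη.continuous.continuousOn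
    have hpos : 0 < η x0 :=
      lt_of_le_of_ne (hη0 x0) (Ne.symm (by have := hK'Ω hx0; rwa [← hηs] at this))
    obtain ⟨m1, hm1⟩ := exists_nat_one_div_lt hpos
    obtain ⟨R, hR⟩ := hK'.isBounded.subset_closedBall 0
    obtain ⟨m2, hm2⟩ := exists_nat_ge R
    refine ⟨max m1 m2, fun x hx => ⟨?_, ?_⟩⟩
    · refine le_trans ?_ (hm1.le.trans (hmin hx))
      have : (m1 : ℝ) ≤ ((max m1 m2 : ℕ) : ℝ) := by exact_mod_cast le_max_left _ _
      exact one_div_le_one_div_of_le (by positivity) (by linarith)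
    · refine closedBall_subset_closedBall (hm2.trans ?_) (hR hx)
      exact_mod_cast le_max_right _ _
  refine ⟨fun m => {x | 1 / ((m : ℝ) + 1) ≤ η x} ∩ closedBall 0 m, fun m => ?_, ?_, hsub, ?_, hex⟩
  · exact (isCompact_closedBall _ _).inter_left (isClosed_le continuous_const hη.continuous)
  · intro a b hab x hx
    have hab' : (a : ℝ) ≤ b := by exact_mod_cast hab
    have h1 : 1 / ((b : ℝ) + 1) ≤ 1 / ((a : ℝ) + 1) :=
      one_div_le_one_div_of_le (by positivity) (by linarith)
    refine ⟨h1.trans hx.1, ?_⟩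
    exact closedBall_subset_closedBall hab' hx.2
  · refine Set.Subset.antisymm (Set.iUnion_subset hsub) fun x hx => ?_
    obtain ⟨m, hm⟩ := hex {x} isCompact_singleton (Set.singleton_subset_iff.2 hx)
    exact Set.mem_iUnion.2 ⟨m, hm rfl⟩

open scoped Manifold in
lemma exists_cutoff (hΩ : IsOpen Ω) {K : Set (EuclideanSpace ℝ (Fin n))} (hK : IsCompact K)
    (hKΩ : K ⊆ Ω) :
    ∃ χ : EuclideanSpace ℝ (Fin n) → ℝ, ContDiff ℝ 1 χ ∧ HasCompactSupport χ ∧ tsupport χ ⊆ Ω ∧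
      (∀ x, 0 ≤ χ x) ∧ (∀ x, χ x ≤ 1) ∧ ∀ x ∈ K, χ x = 1 := by
  obtain ⟨L, hL, hKL, hLΩ⟩ := exists_compact_between hK hΩ hKΩ
  obtain ⟨χ, h0, h1, h2⟩ := exists_contMDiffMap_zero_one_of_isClosed (n := 1)
    𝓘(ℝ, EuclideanSpace ℝ (Fin n)) (isOpen_interior (s := L)).isClosed_compl hK.isClosed
    (Set.disjoint_left.2 fun x hx hx' => hx (hKL hx'))
  have hsupp : Function.support χ ⊆ L := by
    intro x hx
    by_contra h
    exact hx (h0 fun h' => h (interior_subset h'))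
  refine ⟨χ, χ.contMDiff.contDiff, HasCompactSupport.of_support_subset_isCompact hL hsupp,
    (closure_minimal hsupp hL.isClosed).trans hLΩ, fun x => (h2 x).1, fun x => (h2 x).2,
    fun x hx => h1 hx⟩

end Exhaustion

section GradientBound

variable {n : ℕ} {Ω : Set (EuclideanSpace ℝ (Fin n))}

/-- The vector representing a linear functional on `ℝⁿ`. -/
def clmVec (l : EuclideanSpace ℝ (Fin n) →L[ℝ] ℝ) : EuclideanSpace ℝ (Fin n) :=
  WithLp.toLp 2 fun i => l (EuclideanSpace.single i 1)

lemma inner_clmVec (l : EuclideanSpace ℝ (Fin n) →L[ℝ] ℝ) (v : EuclideanSpace ℝ (Fin n)) :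
    ⟪clmVec l, v⟫ = l v := by
  rw [← sum_clm_single l v, PiLp.inner_apply]
  refine Finset.sum_congr rfl fun i _ => ?_
  simp [clmVec, mul_comm]

lemma clm_clmVec (l : EuclideanSpace ℝ (Fin n) →L[ℝ] ℝ) : l (clmVec l) = ‖clmVec l‖ ^ 2 := by
  rw [← inner_clmVec, real_inner_self_eq_norm_sq]

lemma norm_clmVec (l : EuclideanSpace ℝ (Fin n) →L[ℝ] ℝ) : ‖clmVec l‖ = ‖l‖ := by
  apply le_antisymm
  · have h1 := (le_abs_self _).trans (l.le_opNorm (clmVec l))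
    rw [clm_clmVec, sq] at h1
    rcases (norm_nonneg (clmVec l)).eq_or_lt with h | h
    · rw [← h]; exact norm_nonneg l
    · exact le_of_mul_le_mul_right h1 h
  · refine l.opNorm_le_bound (norm_nonneg _) fun v => ?_
    rw [← inner_clmVec, Real.norm_eq_abs]
    exact abs_real_inner_le_norm _ _

lemma sub_le_sq_div_sqrt {t δ : ℝ} (ht : 0 ≤ t) (hδ : 0 < δ) : t - δ ≤ t ^ 2 / √(δ ^ 2 + t ^ 2) := by
  have h0 : 0 < √(δ ^ 2 + t ^ 2) := Real.sqrt_pos.2 (by positivity)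
  rw [le_div_iff₀ h0]
  have h1 : √(δ ^ 2 + t ^ 2) ≤ δ + t := by
    rw [Real.sqrt_le_left (by positivity)]; nlinarith
  have h2 : t ≤ √(δ ^ 2 + t ^ 2) := Real.le_sqrt_of_sq_le (by nlinarith)
  rcases le_total t δ with h | h
  · nlinarith [mul_nonneg (sub_nonneg.2 h) h0.le]
  · nlinarith [mul_le_mul_of_nonneg_left h1 (sub_nonneg.2 h)]

/-- A function whose distributional variation is bounded by `M` has `L¹`-norm of the gradient
bounded by `M`. -/
lemma lintegral_enorm_fderiv_le {u : EuclideanSpace ℝ (Fin n) → ℝ} (hΩ : IsOpen Ω)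
    (hu : ContDiffOn ℝ 2 u Ω) {M : ℝ}
    (hM : ∀ Φ : EuclideanSpace ℝ (Fin n) → EuclideanSpace ℝ (Fin n), ContDiff ℝ 1 Φ →
      HasCompactSupport Φ → tsupport Φ ⊆ Ω → (∀ x, ‖Φ x‖ ≤ 1) →
      ∫ x in Ω, u x * vdiv n Φ x ≤ M) :
    ∫⁻ x in Ω, ‖fderiv ℝ u x‖ₑ ≤ ENNReal.ofReal M := by
  have hu1 : ContDiffOn ℝ 1 u Ω := hu.of_le (by norm_num)
  have hcd : ContinuousOn (fderiv ℝ u) Ω := hu1.continuousOn_fderiv_of_isOpen hΩ le_rfl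
  have key : ∀ K, IsCompact K → K ⊆ Ω → ∫⁻ x in K, ‖fderiv ℝ u x‖ₑ ≤ ENNReal.ofReal M := by
    intro K hK hKΩ
    obtain ⟨χ, hχ, hχc, hχs, hχ0, hχ1, hχK⟩ := exists_cutoff hΩ hK hKΩ
    have hbound : ∀ δ : ℝ, 0 < δ → ∫ x in K, ‖fderiv ℝ u x‖ ≤ M + δ * ∫ x, χ x := by
      intro δ hδ
      set g : EuclideanSpace ℝ (Fin n) → EuclideanSpace ℝ (Fin n) := fun x => clmVec (fderiv ℝ u x)
        with hg
      have hgc : ∀ x ∈ Ω, ContDiffAt ℝ 1 g x := by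
        intro x hx
        refine contDiffAt_euclidean.2 fun i => ?_
        have : ContDiffAt ℝ 1 (fderiv ℝ u) x :=
          (hu.contDiffAt (hΩ.mem_nhds hx)).fderiv_right (by norm_num)
        exact this.clm_apply contDiffAt_const
      set Φ : EuclideanSpace ℝ (Fin n) → EuclideanSpace ℝ (Fin n) := fun x =>
        (-(χ x * (√(δ ^ 2 + ‖g x‖ ^ 2))⁻¹)) • g x with hΦ
      have hpos : ∀ x, 0 < δ ^ 2 + ‖g x‖ ^ 2 := fun x => by positivity
      have hΦ0 : ∀ x ∉ tsupport χ, Φ x = 0 := fun x hx => by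
        simp [hΦ, image_eq_zero_of_notMem_tsupport hx]
      have hΦts : tsupport Φ ⊆ tsupport χ :=
        closure_minimal (fun x hx => by by_contra h; exact hx (hΦ0 x h)) (isClosed_tsupport _)
      have hΦd : ContDiff ℝ 1 Φ := by
        refine contDiff_of_contDiffAt_tsupport (isClosed_tsupport χ) hΦ0 fun x hx => ?_
        have hgx := hgc x (hχs hx)
        have h1 : ContDiffAt ℝ 1 (fun x => √(δ ^ 2 + ‖g x‖ ^ 2)) x :=
          (contDiffAt_const.add (hgx.norm_sq ℝ)).sqrt (hpos x).ne'
        have h2 := h1.inv (Real.sqrt_pos.2 (hpos x)).ne'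
        exact ContDiffAt.smul (hχ.contDiffAt.mul h2).neg hgx
      have hΦc : HasCompactSupport Φ :=
        HasCompactSupport.of_support_subset_isCompact hχc (subset_closure.trans hΦts)
      have hΦ1 : ∀ x, ‖Φ x‖ ≤ 1 := by
        intro x
        have h0 := Real.sqrt_pos.2 (hpos x)
        rw [hΦ]
        simp only [norm_smul, norm_neg, Real.norm_eq_abs, abs_mul, abs_inv,
          abs_of_nonneg (hχ0 x), abs_of_pos h0]
        have h2 : ‖g x‖ ≤ √(δ ^ 2 + ‖g x‖ ^ 2) := Real.le_sqrt_of_sq_le (by nlinarith)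
        have h3 : (√(δ ^ 2 + ‖g x‖ ^ 2))⁻¹ * ‖g x‖ ≤ 1 := by
          rw [inv_mul_le_iff₀ h0]; linarith
        rw [mul_assoc]
        exact mul_le_one₀ (hχ1 x) (by positivity) h3
      have hMΦ := hM Φ hΦd hΦc (hΦts.trans hχs) hΦ1
      rw [setIntegral_mul_vdiv hΩ hu1 hΦd hΦc (hΦts.trans hχs), ← integral_neg,
        setIntegral_eq_integral_of_forall_compl_eq_zero] at hMΦ
      swap
      · intro x hx
        rw [hΦ0 x (fun h => hx (hχs h)), map_zero, neg_zero]
      have hi1 : Integrable (fun x => -(fderiv ℝ u x (Φ x))) :=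
        integrable_of_continuousOn_of_eq_zero hχc
          ((hcd.mono hχs).clm_apply hΦd.continuous.continuousOn).neg
          (fun x hx => by rw [hΦ0 x hx, map_zero, neg_zero])
      have hi2 : Integrable (fun x => χ x * ‖fderiv ℝ u x‖) :=
        integrable_of_continuousOn_of_eq_zero hχc
          (hχ.continuous.continuousOn.mul (hcd.mono hχs).norm)
          (fun x hx => by rw [image_eq_zero_of_notMem_tsupport hx, zero_mul])
      have hi3 : Integrable χ := hχ.continuous.integrable_of_hasCompactSupport hχc
      calc ∫ x in K, ‖fderiv ℝ u x‖ = ∫ x in K, χ x * ‖fderiv ℝ u x‖ :=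
            setIntegral_congr_fun hK.measurableSet fun x hx => by simp [hχK x hx]
        _ ≤ ∫ x, χ x * ‖fderiv ℝ u x‖ :=
            setIntegral_le_integral hi2 (Eventually.of_forall fun x =>
              mul_nonneg (hχ0 x) (norm_nonneg _))
        _ ≤ ∫ x, (-(fderiv ℝ u x (Φ x)) + δ * χ x) := by
            refine integral_mono hi2 (hi1.add (hi3.const_mul δ)) fun x => ?_
            have h1 : -(fderiv ℝ u x (Φ x)) =
                χ x * (‖fderiv ℝ u x‖ ^ 2 / √(δ ^ 2 + ‖fderiv ℝ u x‖ ^ 2)) := by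
              simp only [hΦ, hg, map_smul, smul_eq_mul, clm_clmVec, norm_clmVec]
              ring
            have h2 := mul_le_mul_of_nonneg_left
              (sub_le_sq_div_sqrt (norm_nonneg (fderiv ℝ u x)) hδ) (hχ0 x)
            dsimp only
            rw [h1]
            linarith
        _ ≤ M + δ * ∫ x, χ x := by
            rw [integral_add hi1 (hi3.const_mul δ), integral_const_mul]
            linarith
    have hle : ∫ x in K, ‖fderiv ℝ u x‖ ≤ M := by
      have hlim : Tendsto (fun δ : ℝ => M + δ * ∫ x, χ x) (𝓝[>] 0) (𝓝 (M + 0 * ∫ x, χ x)) :=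
        (Continuous.tendsto (by fun_prop) 0).mono_left nhdsWithin_le_nhds
      rw [zero_mul, add_zero] at hlim
      exact ge_of_tendsto hlim (by filter_upwards [self_mem_nhdsWithin] with δ hδ using hbound δ hδ)
    rw [← ofReal_integral_norm_eq_lintegral_enorm ((hcd.mono hKΩ).integrableOn_compact hK)]
    exact ENNReal.ofReal_le_ofReal hle
  obtain ⟨K, hK, hmono, hKΩ, hU, -⟩ := exists_compact_exhaustion hΩ
  rw [← hU, setLIntegral_iUnion_of_directed _ hmono.directed_le]
  exact iSup_le fun m => key _ (hK m) (hKΩ m)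

end GradientBound

section Mollifier

variable {n : ℕ}

/-- A radially decreasing `C²` mollifier supported in the unit ball. -/
structure IsMollifier (ρ : EuclideanSpace ℝ (Fin n) → ℝ) : Prop where
  contDiff : ContDiff ℝ 2 ρ
  nonneg : ∀ w, 0 ≤ ρ w
  eq_zero : ∀ w, 1 ≤ ‖w‖ → ρ w = 0
  anti : ∀ w w', ‖w‖ ≤ ‖w'‖ → ρ w' ≤ ρ w
  integral_eq_one : ∫ w, ρ w = 1

lemma exists_isMollifier (n : ℕ) : ∃ ρ : EuclideanSpace ℝ (Fin n) → ℝ, IsMollifier ρ := by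
  set σ : EuclideanSpace ℝ (Fin n) → ℝ := fun w => expNegInvGlue (1 - ‖w‖ ^ 2) with hσ
  have hcd : ContDiff ℝ 2 σ :=
    expNegInvGlue.contDiff.comp (contDiff_const.sub (contDiff_norm_sq ℝ))
  have h0 : ∀ w, 0 ≤ σ w := fun w => expNegInvGlue.nonneg _
  have hz : ∀ w, 1 ≤ ‖w‖ → σ w = 0 := fun w hw =>
    expNegInvGlue.zero_of_nonpos (by nlinarith)
  have ha : ∀ w w', ‖w‖ ≤ ‖w'‖ → σ w' ≤ σ w := fun w w' h =>
    expNegInvGlue.monotone (by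
      have := pow_le_pow_left₀ (norm_nonneg w) h 2
      linarith)
  have hc : HasCompactSupport σ :=
    HasCompactSupport.of_support_subset_isCompact (isCompact_closedBall 0 1) fun w hw => by
      rw [mem_closedBall_zero_iff]
      by_contra h
      exact hw (hz w (not_le.1 h).le)
  have hpos : 0 < ∫ w, σ w :=
    hcd.continuous.integral_pos_of_hasCompactSupport_nonneg_nonzero hc h0 (x := 0)
      (expNegInvGlue.pos_of_pos (by simp)).ne'
  refine ⟨fun w => (∫ w, σ w)⁻¹ * σ w, contDiff_const.mul hcd, fun w => ?_, fun w hw => ?_,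
    fun w w' h => ?_, ?_⟩
  · exact mul_nonneg (inv_nonneg.2 hpos.le) (h0 w)
  · simp only [hz w hw, mul_zero]
  · exact mul_le_mul_of_nonneg_left (ha w w' h) (inv_nonneg.2 hpos.le)
  · rw [integral_const_mul, inv_mul_cancel₀ hpos.ne']

lemma IsMollifier.integral_scale {ρ : EuclideanSpace ℝ (Fin n) → ℝ} (hρ : IsMollifier ρ) {a : ℝ}
    (ha : 0 < a) (y : EuclideanSpace ℝ (Fin n)) : ∫ x, a ^ n * ρ (a • (y - x)) = 1 := by
  rw [integral_const_mul, integral_sub_left_eq_self (fun x => ρ (a • x)) volume y,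
    Measure.integral_comp_smul, hρ.integral_eq_one, finrank_euclideanSpace, Fintype.card_fin,
    abs_of_pos (by positivity), smul_eq_mul, mul_one, mul_inv_cancel₀ (by positivity)]

lemma IsMollifier.hasCompactSupport {ρ : EuclideanSpace ℝ (Fin n) → ℝ} (hρ : IsMollifier ρ) :
    HasCompactSupport ρ :=
  HasCompactSupport.of_support_subset_isCompact (isCompact_closedBall 0 1) fun w hw => by
    rw [mem_closedBall_zero_iff]
    by_contra h
    exact hw (hρ.eq_zero w (not_le.1 h).le)

lemma IsMollifier.integrable_scale {ρ : EuclideanSpace ℝ (Fin n) → ℝ} (hρ : IsMollifier ρ) {a : ℝ}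
    (ha : 0 < a) (y : EuclideanSpace ℝ (Fin n)) :
    Integrable fun x => a ^ n * ρ (a • (y - x)) :=
  (((hρ.contDiff.continuous.integrable_of_hasCompactSupport hρ.hasCompactSupport).comp_smul
    ha.ne').comp_sub_left y).const_mul _

/-- A `C²` length scale on an open set `Ω`, vanishing exactly outside of `Ω`. -/
structure IsScale (Ω : Set (EuclideanSpace ℝ (Fin n))) (c : ℝ)
    (h : EuclideanSpace ℝ (Fin n) → ℝ) : Prop where
  contDiff : ContDiff ℝ 2 h
  nonneg : ∀ x, 0 ≤ h x
  support_eq : Function.support h = Ω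
  lip : ∀ x y, |h x - h y| ≤ c * ‖x - y‖
  pos : 0 < c
  lt_one : c < 1

variable {Ω : Set (EuclideanSpace ℝ (Fin n))} {c : ℝ} {h : EuclideanSpace ℝ (Fin n) → ℝ}
  {ρ : EuclideanSpace ℝ (Fin n) → ℝ}

lemma IsScale.pos_of_mem (hh : IsScale Ω c h) {x : EuclideanSpace ℝ (Fin n)} (hx : x ∈ Ω) :
    0 < h x :=
  lt_of_le_of_ne (hh.nonneg x) (Ne.symm (by rwa [← hh.support_eq] at hx))

lemma IsScale.mem_of_pos (hh : IsScale Ω c h) {x : EuclideanSpace ℝ (Fin n)} (hx : 0 < h x) :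
    x ∈ Ω := by rw [← hh.support_eq]; exact hx.ne'

lemma IsScale.lower (hh : IsScale Ω c h) {x y : EuclideanSpace ℝ (Fin n)} (hxy : ‖y - x‖ ≤ h x) :
    (1 - c) * h x ≤ h y := by
  have h1 := (le_abs_self _).trans (hh.lip x y)
  rw [norm_sub_rev] at h1
  have := mul_le_mul_of_nonneg_left hxy hh.pos.le
  linarith

lemma IsScale.upper (hh : IsScale Ω c h) {x y : EuclideanSpace ℝ (Fin n)} (hxy : ‖y - x‖ ≤ h x) :
    h y ≤ (1 + c) * h x := by
  have h1 := (le_abs_self _).trans (hh.lip y x)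
  have := mul_le_mul_of_nonneg_left hxy hh.pos.le
  linarith

lemma IsScale.mem_of_norm_sub_le (hh : IsScale Ω c h) {x y : EuclideanSpace ℝ (Fin n)}
    (hx : x ∈ Ω) (hxy : ‖y - x‖ ≤ h x) : y ∈ Ω :=
  hh.mem_of_pos ((mul_pos (by linarith [hh.lt_one]) (hh.pos_of_mem hx)).trans_le (hh.lower hxy))

/-- The mollification kernel with variable length scale `h`. -/
def mollKernel (ρ h : EuclideanSpace ℝ (Fin n) → ℝ) (x y : EuclideanSpace ℝ (Fin n)) : ℝ :=
  (h x)⁻¹ ^ n * ρ ((h x)⁻¹ • (y - x))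

lemma mollKernel_nonneg (hρ : IsMollifier ρ) (hh : IsScale Ω c h)
    (x y : EuclideanSpace ℝ (Fin n)) : 0 ≤ mollKernel ρ h x y :=
  mul_nonneg (pow_nonneg (inv_nonneg.2 (hh.nonneg x)) _) (hρ.nonneg _)

lemma mollKernel_eq_zero (hρ : IsMollifier ρ) (hh : IsScale Ω c h)
    {x y : EuclideanSpace ℝ (Fin n)} (hx : x ∈ Ω) (hxy : h x ≤ ‖y - x‖) :
    mollKernel ρ h x y = 0 := by
  have hp := hh.pos_of_mem hx
  rw [mollKernel, hρ.eq_zero, mul_zero]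
  rw [norm_smul, norm_inv, Real.norm_of_nonneg hp.le, ← div_eq_inv_mul, one_le_div hp]
  exact hxy

lemma mollKernel_le (hρ : IsMollifier ρ) (hh : IsScale Ω c h)
    {x y : EuclideanSpace ℝ (Fin n)} (hx : x ∈ Ω) (hy : y ∈ Ω) :
    mollKernel ρ h x y ≤ ((1 + c) / (1 - c)) ^ n *
      (((1 - c) / h y) ^ n * ρ (((1 - c) / h y) • (y - x))) := by
  have hpx := hh.pos_of_mem hx
  have hpy := hh.pos_of_mem hy
  have hc := hh.pos
  have hc' : 0 < 1 - c := by linarith [hh.lt_one]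
  rcases le_total (h x) ‖y - x‖ with hle | hle
  · rw [mollKernel_eq_zero hρ hh hx hle]
    have := hρ.nonneg (((1 - c) / h y) • (y - x))
    positivity
  · have h1 := hh.lower hle
    have h2 := hh.upper hle
    rw [← mul_assoc, ← mul_pow, div_mul_div_cancel₀ hc'.ne', mollKernel]
    refine mul_le_mul ?_ (hρ.anti _ _ ?_) (hρ.nonneg _) (by positivity)
    · refine pow_le_pow_left₀ (by positivity) ?_ n
      rw [inv_eq_one_div, div_le_div_iff₀ hpx hpy]
      linarith
    · rw [norm_smul, norm_smul, Real.norm_of_nonneg (by positivity),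
        Real.norm_of_nonneg (by positivity)]
      refine mul_le_mul_of_nonneg_right ?_ (norm_nonneg _)
      rw [inv_eq_one_div, div_le_div_iff₀ hpy hpx]
      linarith

lemma integral_mollKernel (hρ : IsMollifier ρ) (hh : IsScale Ω c h)
    {x : EuclideanSpace ℝ (Fin n)} (hx : x ∈ Ω) : ∫ y, mollKernel ρ h x y = 1 := by
  have hp := hh.pos_of_mem hx
  unfold mollKernel
  rw [integral_const_mul, integral_sub_right_eq_self (fun y => ρ ((h x)⁻¹ • y)) x,
    Measure.integral_comp_smul, hρ.integral_eq_one, finrank_euclideanSpace, Fintype.card_fin,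
    abs_of_pos (by positivity), smul_eq_mul, mul_one, mul_inv_cancel₀ (by positivity)]

lemma contDiffAt_mollKernel (hρ : IsMollifier ρ) (hh : IsScale Ω c h)
    {z : EuclideanSpace ℝ (Fin n) × EuclideanSpace ℝ (Fin n)} (hz : z.1 ∈ Ω) :
    ContDiffAt ℝ 2 (fun z : EuclideanSpace ℝ (Fin n) × EuclideanSpace ℝ (Fin n) =>
      mollKernel ρ h z.1 z.2) z := by
  have h1 : ContDiffAt ℝ 2 (fun z : EuclideanSpace ℝ (Fin n) × EuclideanSpace ℝ (Fin n) =>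
      (h z.1)⁻¹) z :=
    (hh.contDiff.comp contDiff_fst).contDiffAt.inv (hh.pos_of_mem hz).ne'
  exact (h1.pow n).mul (hρ.contDiff.contDiffAt.comp z
    (ContDiffAt.smul h1 (contDiff_snd.sub contDiff_fst).contDiffAt))

lemma isCompact_dilation (hh : IsScale Ω c h) {S : Set (EuclideanSpace ℝ (Fin n))}
    (hS : IsCompact S) (hSΩ : S ⊆ Ω) : ∃ L, IsCompact L ∧ L ⊆ Ω ∧
      ∀ x ∈ S, ∀ y, ‖y - x‖ ≤ h x → y ∈ L := by
  refine ⟨(fun z : EuclideanSpace ℝ (Fin n) × EuclideanSpace ℝ (Fin n) => z.1 + h z.1 • z.2) ''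
    (S ×ˢ closedBall 0 1), (hS.prod (isCompact_closedBall _ _)).image ?_, ?_, ?_⟩
  · have := hh.contDiff.continuous
    fun_prop
  · rintro _ ⟨⟨x, w⟩, ⟨hx, hw⟩, rfl⟩
    refine hh.mem_of_norm_sub_le (hSΩ hx) ?_
    have hw' : ‖w‖ ≤ 1 := by simpa using hw
    simp only [add_sub_cancel_left, norm_smul, Real.norm_of_nonneg (hh.nonneg x)]
    exact mul_le_of_le_one_right (hh.nonneg x) hw'
  · intro x hx y hxy
    have hp := hh.pos_of_mem (hSΩ hx)
    refine ⟨(x, (h x)⁻¹ • (y - x)), ⟨hx, ?_⟩, ?_⟩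
    · simp only [mem_closedBall_zero_iff, norm_smul, norm_inv, Real.norm_of_nonneg hp.le]
      rwa [← div_eq_inv_mul, div_le_one hp]
    · simp [smul_smul, mul_inv_cancel₀ hp.ne']

end Mollifier

section VarMollify

variable {n : ℕ} {Ω : Set (EuclideanSpace ℝ (Fin n))} {c : ℝ}
  {h ρ f : EuclideanSpace ℝ (Fin n) → ℝ}

/-- Mollification of `f` with variable length scale `h`. -/
def varMollify (ρ h f : EuclideanSpace ℝ (Fin n) → ℝ) (x : EuclideanSpace ℝ (Fin n)) : ℝ :=
  ∫ y, f y * mollKernel ρ h x y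

lemma contDiffOn_varMollify (hρ : IsMollifier ρ) (hΩ : IsOpen Ω) (hh : IsScale Ω c h)
    (hf : LocallyIntegrableOn f Ω) : ContDiffOn ℝ 2 (varMollify ρ h f) Ω := by
  intro x0 hx0
  obtain ⟨r, hr, hrΩ⟩ := Metric.nhds_basis_closedBall.mem_iff.1 (hΩ.mem_nhds hx0)
  obtain ⟨L, hL, hLΩ, hLmem⟩ := isCompact_dilation hh (isCompact_closedBall x0 r) hrΩ
  have hzero : ∀ p ∈ ball x0 r, ∀ y ∉ L, mollKernel ρ h p y = 0 := fun p hp y hy => by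
    refine mollKernel_eq_zero hρ hh (hrΩ (ball_subset_closedBall hp)) ?_
    by_contra hlt
    exact hy (hLmem p (ball_subset_closedBall hp) y (not_le.1 hlt).le)
  have hfi : LocallyIntegrable (L.indicator f) :=
    ((integrable_indicator_iff hL.measurableSet).2
      (hf.integrableOn_compact_subset hLΩ hL)).locallyIntegrable
  have hconv := contDiffOn_convolution_right_with_param (μ := volume) (n := 2)
    (ContinuousLinearMap.mul ℝ ℝ) (f := L.indicator f)
    (g := fun p t => mollKernel ρ h p (-t)) (s := ball x0 r) (k := -L) isOpen_ball hL.neg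
    (fun p t hp ht => hzero p hp _ (by simpa using ht)) hfi (by
      rintro ⟨p, t⟩ ⟨hp, -⟩
      refine ContDiffAt.contDiffWithinAt ?_
      have h1 : ContDiffAt ℝ 2 (fun z : EuclideanSpace ℝ (Fin n) × EuclideanSpace ℝ (Fin n) =>
        mollKernel ρ h z.1 z.2) (p, -t) :=
        contDiffAt_mollKernel hρ hh (hrΩ (ball_subset_closedBall hp))
      have h2 : ContDiff ℝ 2 fun z : EuclideanSpace ℝ (Fin n) × EuclideanSpace ℝ (Fin n) =>
        (z.1, -z.2) := contDiff_fst.prodMk contDiff_snd.neg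
      exact ContDiffAt.comp (p, t) (f := fun z : EuclideanSpace ℝ (Fin n) ×
        EuclideanSpace ℝ (Fin n) => (z.1, -z.2)) h1 h2.contDiffAt)
  have hcomp : ContDiffOn ℝ 2 (fun p => convolution (L.indicator f)
      (fun t => mollKernel ρ h p (-t)) (ContinuousLinearMap.mul ℝ ℝ) volume 0) (ball x0 r) :=
    hconv.comp (f := fun p : EuclideanSpace ℝ (Fin n) => (p, (0 : EuclideanSpace ℝ (Fin n))))
      (contDiff_id.prodMk contDiff_const).contDiffOn (fun p hp => ⟨hp, Set.mem_univ _⟩)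
  have hF : ContDiffOn ℝ 2 (varMollify ρ h f) (ball x0 r) := by
    refine hcomp.congr fun p hp => ?_
    unfold varMollify convolution
    refine integral_congr_ae (Eventually.of_forall fun y => ?_)
    simp only [zero_sub, neg_neg, ContinuousLinearMap.mul_apply']
    by_cases hy : y ∈ L
    · rw [Set.indicator_of_mem hy]
    · rw [hzero p hp y hy, mul_zero, mul_zero]
  exact (hF.contDiffAt (isOpen_ball.mem_nhds (mem_ball_self hr))).contDiffWithinAt

end VarMollify

section Parametric

variable {n : ℕ}

/-- Differentiation under the integral sign for a compactly supported `C¹` kernel. -/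
lemma contDiff_parametric_integral
    {N : EuclideanSpace ℝ (Fin n) → EuclideanSpace ℝ (Fin n) → EuclideanSpace ℝ (Fin n)}
    (hN : ContDiff ℝ 1 fun z : EuclideanSpace ℝ (Fin n) × EuclideanSpace ℝ (Fin n) => N z.1 z.2)
    {S L : Set (EuclideanSpace ℝ (Fin n))} (hS : IsCompact S) (hL : IsCompact L)
    (h0 : ∀ x y, (x, y) ∉ S ×ˢ L → N x y = 0) :
    ContDiff ℝ 1 (fun y => ∫ x, N x y) ∧
      ∀ y, vdiv n (fun y => ∫ x, N x y) y = ∫ x, vdiv n (N x) y := by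
  set N' : EuclideanSpace ℝ (Fin n) → EuclideanSpace ℝ (Fin n) →
      (EuclideanSpace ℝ (Fin n) →L[ℝ] EuclideanSpace ℝ (Fin n)) := fun y x => fderiv ℝ (N x) y
    with hN'
  have hcomp : ∀ x, ContDiff ℝ 1 (N x) := fun x =>
    hN.comp (contDiff_prodMk_right x)
  have hcont : Continuous fun z : EuclideanSpace ℝ (Fin n) × EuclideanSpace ℝ (Fin n) =>
      N' z.2 z.1 := by
    have h1 : Continuous (fderiv ℝ fun z : EuclideanSpace ℝ (Fin n) × EuclideanSpace ℝ (Fin n) =>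
      N z.1 z.2) := hN.continuous_fderiv (by norm_num)
    have h2 : (fun z : EuclideanSpace ℝ (Fin n) × EuclideanSpace ℝ (Fin n) => N' z.2 z.1) =
        fun z => (fderiv ℝ (fun z : EuclideanSpace ℝ (Fin n) × EuclideanSpace ℝ (Fin n) =>
          N z.1 z.2) z).comp (ContinuousLinearMap.inr ℝ _ _) := by
      ext1 z
      have h3 := ((hN.differentiable (by norm_num)) (z.1, z.2)).hasFDerivAt.comp z.2
        (hasFDerivAt_prodMk_right z.1 z.2)
      exact HasFDerivAt.fderiv h3
    rw [h2]
    fun_prop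
  have h0' : ∀ x y, (x, y) ∉ S ×ˢ L → N' y x = 0 := by
    intro x y hxy
    refine (HasFDerivAt.congr_of_eventuallyEq (hasFDerivAt_const 0 y) ?_).fderiv
    by_cases hx : x ∈ S
    · have hy : y ∉ L := fun hy => hxy ⟨hx, hy⟩
      filter_upwards [hL.isClosed.isOpen_compl.mem_nhds hy] with y' hy'
      exact h0 x y' fun h => hy' h.2
    · exact Eventually.of_forall fun y' => h0 x y' fun h => hx h.1
  obtain ⟨C, hC⟩ := (hS.prod hL).exists_bound_of_continuousOn hcont.continuousOn
  have hbound : ∀ y x, ‖N' y x‖ ≤ S.indicator (fun _ => max C 0) x := by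
    intro y x
    by_cases hxy : (x, y) ∈ S ×ˢ L
    · rw [Set.indicator_of_mem hxy.1]
      exact (hC _ hxy).trans (le_max_left _ _)
    · rw [h0' x y hxy, norm_zero]
      exact Set.indicator_nonneg (fun _ _ => le_max_right _ _) _
  have hbi : Integrable (S.indicator (fun _ => max C 0)) :=
    (integrable_indicator_iff hS.measurableSet).2
      (integrableOn_const (hs := hS.measure_lt_top.ne))
  have hN'meas : ∀ y, Continuous (N' y) := fun y =>
    hcont.comp (by fun_prop : Continuous fun x : EuclideanSpace ℝ (Fin n) => (x, y))
  have hNint : ∀ y, Integrable fun x => N x y := fun y =>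
    integrable_of_continuousOn_of_eq_zero hS
      (hN.continuous.comp (by fun_prop : Continuous fun x : EuclideanSpace ℝ (Fin n) =>
        (x, y))).continuousOn fun x hx => h0 x y fun h => hx h.1
  have hder : ∀ y, HasFDerivAt (fun y => ∫ x, N x y) (∫ x, N' y x) y := fun y =>
    hasFDerivAt_integral_of_dominated_of_fderiv_le (F := fun y x => N x y) (F' := N')
      (s := Set.univ) Filter.univ_mem
      (Eventually.of_forall fun y => (hNint y).aestronglyMeasurable) (hNint y)
      (hN'meas y).aestronglyMeasurable (Eventually.of_forall fun x y _ => hbound y x) hbi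
      (Eventually.of_forall fun x y _ => ((hcomp x).differentiable (by norm_num) y).hasFDerivAt)
  refine ⟨contDiff_one_iff_fderiv.2 ⟨fun y => (hder y).differentiableAt, ?_⟩, fun y => ?_⟩
  · have : fderiv ℝ (fun y => ∫ x, N x y) = fun y => ∫ x, N' y x := by
      ext1 y; exact (hder y).fderiv
    rw [this]
    refine continuous_of_dominated (fun y => (hN'meas y).aestronglyMeasurable)
      (fun y => Eventually.of_forall fun x => hbound y x) hbi (Eventually.of_forall fun x => ?_)
    exact hcont.comp (by fun_prop : Continuous fun y : EuclideanSpace ℝ (Fin n) => (x, y))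
  · have hi : Integrable (N' y) :=
      hbi.mono' (hN'meas y).aestronglyMeasurable (Eventually.of_forall fun x => hbound y x)
    unfold vdiv
    rw [(hder y).fderiv, integral_finsetSum]
    · refine Finset.sum_congr rfl fun i _ => ?_
      rw [ContinuousLinearMap.integral_apply hi]
      exact ((EuclideanSpace.proj (𝕜 := ℝ) i).integral_comp_comm
        (hi.apply_continuousLinearMap _)).symm
    · intro i _
      exact (EuclideanSpace.proj (𝕜 := ℝ) i).integrable_comp (hi.apply_continuousLinearMap _)

end Parametric

section Commutation

variable {n : ℕ} {Ω : Set (EuclideanSpace ℝ (Fin n))} {c : ℝ}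
  {h ρ f : EuclideanSpace ℝ (Fin n) → ℝ}

lemma IsScale.abs_fderiv_le (hh : IsScale Ω c h) (x v : EuclideanSpace ℝ (Fin n)) :
    |fderiv ℝ h x v| ≤ c * ‖v‖ := by
  have hl : LipschitzWith ⟨c, hh.pos.le⟩ h := LipschitzWith.of_dist_le_mul fun x y => by
    rw [Real.dist_eq, dist_eq_norm]; exact hh.lip x y
  exact (ContinuousLinearMap.le_opNorm _ _).trans
    (mul_le_mul_of_nonneg_right (norm_fderiv_le_of_lipschitz ℝ hl) (norm_nonneg v))

/-- The kernel transporting a vector field through mollification with variable length scale. -/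
def dualKernel (ρ h : EuclideanSpace ℝ (Fin n) → ℝ)
    (Φ : EuclideanSpace ℝ (Fin n) → EuclideanSpace ℝ (Fin n))
    (x y : EuclideanSpace ℝ (Fin n)) : EuclideanSpace ℝ (Fin n) :=
  mollKernel ρ h x y • (Φ x + (fderiv ℝ h x (Φ x) * (h x)⁻¹) • (y - x))

lemma vdiv_affine (v x y : EuclideanSpace ℝ (Fin n)) (s : ℝ) :
    vdiv n (fun y => v + s • (y - x)) y = n * s := by
  have h1 : HasFDerivAt (fun y => v + s • (y - x))
      (s • ContinuousLinearMap.id ℝ (EuclideanSpace ℝ (Fin n))) y :=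
    (((hasFDerivAt_id y).sub_const x).const_smul s).const_add v
  simp [vdiv, h1.fderiv]

lemma fderiv_mollKernel_left (hρ : IsMollifier ρ) (hh : IsScale Ω c h)
    {x : EuclideanSpace ℝ (Fin n)} (hx : x ∈ Ω) (y v : EuclideanSpace ℝ (Fin n)) :
    fderiv ℝ (fun x => mollKernel ρ h x y) x v =
      -((h x)⁻¹ ^ n * ρ ((h x)⁻¹ • (y - x)) * (n * (fderiv ℝ h x v * (h x)⁻¹)) +
        (h x)⁻¹ ^ n * fderiv ℝ ρ ((h x)⁻¹ • (y - x))
          ((h x)⁻¹ • (v + (fderiv ℝ h x v * (h x)⁻¹) • (y - x)))) := by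
  have hp := hh.pos_of_mem hx
  set s := fderiv ℝ h x v with hs
  have hline : HasDerivAt (fun t : ℝ => x + t • v) v 0 := by
    simpa using ((hasDerivAt_id (0 : ℝ)).smul_const v).const_add x
  have hx0 : x + (0 : ℝ) • v = x := by simp
  have hhd : HasDerivAt (fun t : ℝ => h (x + t • v)) s 0 := by
    have h1 : HasFDerivAt h (fderiv ℝ h x) (x + (0 : ℝ) • v) := by
      rw [hx0]; exact (hh.contDiff.differentiable (by norm_num) x).hasFDerivAt
    exact h1.comp_hasDerivAt (0 : ℝ) hline
  have ha : HasDerivAt (fun t : ℝ => (h (x + t • v))⁻¹) (-s * (h x)⁻¹ ^ 2) 0 := by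
    have := hhd.inv (by rw [hx0]; exact hp.ne')
    rw [hx0] at this
    refine this.congr_deriv ?_
    field_simp
  have hw : HasDerivAt (fun t : ℝ => (h (x + t • v))⁻¹ • (y - (x + t • v)))
      ((h x)⁻¹ • (-v) + (-s * (h x)⁻¹ ^ 2) • (y - x)) 0 := by
    have := HasDerivAt.fun_smul ha (hline.const_sub y)
    simp only [hx0] at this
    exact this
  have hr : HasDerivAt (fun t : ℝ => ρ ((h (x + t • v))⁻¹ • (y - (x + t • v))))
      (fderiv ℝ ρ ((h x)⁻¹ • (y - x)) ((h x)⁻¹ • (-v) + (-s * (h x)⁻¹ ^ 2) • (y - x))) 0 := by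
    have h1 : HasFDerivAt ρ (fderiv ℝ ρ ((h x)⁻¹ • (y - x)))
        ((h (x + (0 : ℝ) • v))⁻¹ • (y - (x + (0 : ℝ) • v))) := by
      rw [hx0]; exact (hρ.contDiff.differentiable (by norm_num) _).hasFDerivAt
    exact h1.comp_hasDerivAt (0 : ℝ) hw
  have hk := (ha.pow n).mul hr
  have hk2 : HasDerivAt (fun t : ℝ => mollKernel ρ h (x + t • v) y)
      (fderiv ℝ (fun x => mollKernel ρ h x y) x v) 0 := by
    have h1 : DifferentiableAt ℝ (fun x => mollKernel ρ h x y) x :=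
      ((contDiffAt_mollKernel hρ hh (z := (x, y)) hx).comp x
        (contDiff_prodMk_left y).contDiffAt).differentiableAt (by norm_num)
    have h2 : HasFDerivAt (fun x => mollKernel ρ h x y)
        (fderiv ℝ (fun x => mollKernel ρ h x y) x) (x + (0 : ℝ) • v) := by
      rw [hx0]; exact h1.hasFDerivAt
    exact h2.comp_hasDerivAt (0 : ℝ) hline
  rw [hk2.unique hk]
  simp only [hx0, map_add, map_smul, map_neg, smul_eq_mul, Pi.pow_apply]
  rcases n with _ | m
  · simp; ring
  · simp only [Nat.add_sub_cancel]; ring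

lemma vdiv_dualKernel (hρ : IsMollifier ρ) (hh : IsScale Ω c h)
    (Φ : EuclideanSpace ℝ (Fin n) → EuclideanSpace ℝ (Fin n))
    {x : EuclideanSpace ℝ (Fin n)} (hx : x ∈ Ω) (y : EuclideanSpace ℝ (Fin n)) :
    vdiv n (dualKernel ρ h Φ x) y = -fderiv ℝ (fun x => mollKernel ρ h x y) x (Φ x) := by
  have hd : HasFDerivAt (mollKernel ρ h x) (((h x)⁻¹ ^ n) •
      ((fderiv ℝ ρ ((h x)⁻¹ • (y - x))).comp
        ((h x)⁻¹ • ContinuousLinearMap.id ℝ (EuclideanSpace ℝ (Fin n))))) y := by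
    have h1 : HasFDerivAt (fun y => (h x)⁻¹ • (y - x))
        ((h x)⁻¹ • ContinuousLinearMap.id ℝ (EuclideanSpace ℝ (Fin n))) y :=
      ((hasFDerivAt_id y).sub_const x).fun_const_smul _
    have h2 := (hρ.contDiff.differentiable (by norm_num) ((h x)⁻¹ • (y - x))).hasFDerivAt
    exact (h2.comp y h1).const_mul _
  have hdB : DifferentiableAt ℝ
      (fun y => Φ x + (fderiv ℝ h x (Φ x) * (h x)⁻¹) • (y - x)) y := by fun_prop
  have h1 := vdiv_smul hd.differentiableAt hdB
  have h2 : dualKernel ρ h Φ x = fun y => mollKernel ρ h x y •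
    (Φ x + (fderiv ℝ h x (Φ x) * (h x)⁻¹) • (y - x)) := rfl
  rw [h2, h1, fderiv_mollKernel_left hρ hh hx, hd.fderiv, vdiv_affine]
  simp [mollKernel, -mul_eq_mul_left_iff]
  ring

lemma norm_dualKernel_le (hρ : IsMollifier ρ) (hh : IsScale Ω c h)
    {Φ : EuclideanSpace ℝ (Fin n) → EuclideanSpace ℝ (Fin n)} (hΦ : ∀ x, ‖Φ x‖ ≤ 1)
    {x : EuclideanSpace ℝ (Fin n)} (hx : x ∈ Ω) (y : EuclideanSpace ℝ (Fin n)) :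
    ‖dualKernel ρ h Φ x y‖ ≤ (1 + c) * mollKernel ρ h x y := by
  have hp := hh.pos_of_mem hx
  have hk := mollKernel_nonneg hρ hh x y
  rcases le_total (h x) ‖y - x‖ with hle | hle
  · simp [dualKernel, mollKernel_eq_zero hρ hh hx hle]
  · rw [dualKernel, norm_smul, Real.norm_of_nonneg hk, mul_comm]
    refine mul_le_mul_of_nonneg_right ((norm_add_le _ _).trans (add_le_add (hΦ x) ?_)) hk
    rw [norm_smul, norm_mul, norm_inv, Real.norm_of_nonneg hp.le, Real.norm_eq_abs, mul_assoc]
    have h1 : |fderiv ℝ h x (Φ x)| ≤ c :=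
      (hh.abs_fderiv_le x (Φ x)).trans (mul_le_of_le_one_right hh.pos.le (hΦ x))
    have h2 : (h x)⁻¹ * ‖y - x‖ ≤ 1 := by rw [inv_mul_le_iff₀ hp]; linarith
    calc _ ≤ c * 1 := mul_le_mul h1 h2 (by positivity) hh.pos.le
      _ = c := mul_one c

/-- Testing the mollified function against a vector field amounts to testing the original function
against a slightly larger vector field. -/
lemma exists_dual_field (hρ : IsMollifier ρ) (hΩ : IsOpen Ω) (hh : IsScale Ω c h)
    (hf : LocallyIntegrableOn f Ω) {Φ : EuclideanSpace ℝ (Fin n) → EuclideanSpace ℝ (Fin n)}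
    (hΦ : ContDiff ℝ 1 Φ) (hΦc : HasCompactSupport Φ) (hΦΩ : tsupport Φ ⊆ Ω)
    (hΦ1 : ∀ x, ‖Φ x‖ ≤ 1) :
    ∃ Θ : EuclideanSpace ℝ (Fin n) → EuclideanSpace ℝ (Fin n), ContDiff ℝ 1 Θ ∧
      HasCompactSupport Θ ∧ tsupport Θ ⊆ Ω ∧
      (∀ y, ‖Θ y‖ ≤ (1 + c) * ((1 + c) / (1 - c)) ^ n) ∧
      ∫ x in Ω, varMollify ρ h f x * vdiv n Φ x = ∫ y in Ω, f y * vdiv n Θ y := by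
  have hc := hh.pos
  have hc' : 0 < 1 - c := by linarith [hh.lt_one]
  set S := tsupport Φ with hS
  have hSc : IsCompact S := hΦc
  obtain ⟨L, hL, hLΩ, hLmem⟩ := isCompact_dilation hh hSc hΦΩ
  have hkzero : ∀ x ∈ S, ∀ y ∉ L, mollKernel ρ h x y = 0 := fun x hx y hy => by
    refine mollKernel_eq_zero hρ hh (hΦΩ hx) ?_
    by_contra hlt
    exact hy (hLmem x hx y (not_le.1 hlt).le)
  have hN0 : ∀ x y, (x, y) ∉ S ×ˢ L → dualKernel ρ h Φ x y = 0 := by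
    intro x y hxy
    by_cases hx : x ∈ S
    · rw [dualKernel, hkzero x hx y fun hy => hxy ⟨hx, hy⟩, zero_smul]
    · simp [dualKernel, image_eq_zero_of_notMem_tsupport hx]
  have hN : ContDiff ℝ 1 fun z : EuclideanSpace ℝ (Fin n) × EuclideanSpace ℝ (Fin n) =>
      dualKernel ρ h Φ z.1 z.2 := by
    refine contDiff_of_contDiffAt_tsupport (K := S ×ˢ Set.univ)
      ((isClosed_tsupport Φ).prod isClosed_univ) (fun z hz => ?_) fun z hz => ?_
    · exact hN0 z.1 z.2 fun h => hz ⟨h.1, Set.mem_univ _⟩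
    · have hz1 : z.1 ∈ Ω := hΦΩ hz.1
      have h1 := (contDiffAt_mollKernel hρ hh hz1).of_le (m := 1) (by norm_num)
      have h2 : ContDiffAt ℝ 1 (fun z : EuclideanSpace ℝ (Fin n) × EuclideanSpace ℝ (Fin n) =>
          (h z.1)⁻¹) z :=
        (((hh.contDiff.of_le (by norm_num)).comp contDiff_fst).contDiffAt).inv
          (hh.pos_of_mem hz1).ne'
      have h3 : ContDiff ℝ 1 (fun z : EuclideanSpace ℝ (Fin n) × EuclideanSpace ℝ (Fin n) =>
          fderiv ℝ h z.1) :=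
        (hh.contDiff.fderiv_right (m := 1) (by norm_num)).comp contDiff_fst
      have h4 : ContDiff ℝ 1 (fun z : EuclideanSpace ℝ (Fin n) × EuclideanSpace ℝ (Fin n) =>
          Φ z.1) := hΦ.comp contDiff_fst
      have h5 := (h3.clm_apply h4).contDiffAt (x := z)
      exact ContDiffAt.smul h1 (h4.contDiffAt.add (ContDiffAt.smul (h5.mul h2)
        (contDiff_snd.sub contDiff_fst).contDiffAt))
  obtain ⟨hΘ, hΘdiv⟩ := contDiff_parametric_integral hN hSc hL hN0
  set Θ : EuclideanSpace ℝ (Fin n) → EuclideanSpace ℝ (Fin n) :=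
    fun y => ∫ x, dualKernel ρ h Φ x y with hΘdef
  have hΘ0 : ∀ y ∉ L, Θ y = 0 := fun y hy => by
    simp only [hΘdef, hN0 _ y fun h => hy h.2, integral_zero]
  have hΘL : tsupport Θ ⊆ L :=
    closure_minimal (fun y hy => by by_contra h; exact hy (hΘ0 y h)) hL.isClosed
  have hdivk : ∀ y, vdiv n Θ y = ∫ x in Ω, mollKernel ρ h x y * vdiv n Φ x := by
    intro y
    rw [hΘdiv y, setIntegral_mul_vdiv (u := fun x => mollKernel ρ h x y) hΩ (fun x hx =>
      (((contDiffAt_mollKernel hρ hh (z := (x, y)) hx).comp x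
        (contDiff_prodMk_left y).contDiffAt).of_le (by norm_num)).contDiffWithinAt) hΦ hΦc hΦΩ,
      ← integral_neg, ← setIntegral_eq_integral_of_forall_compl_eq_zero (s := Ω)]
    · exact setIntegral_congr_fun hΩ.measurableSet fun x hx => vdiv_dualKernel hρ hh Φ hx y
    · intro x hx
      have : dualKernel ρ h Φ x = fun _ => 0 := by
        ext1 y; exact hN0 x y fun h => hx (hΦΩ h.1)
      simp [vdiv, this]
  refine ⟨Θ, hΘ, HasCompactSupport.of_support_subset_isCompact hL (subset_closure.trans hΘL),
    hΘL.trans hLΩ, fun y => ?_, ?_⟩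
  · by_cases hy : y ∈ Ω
    · have hpy := hh.pos_of_mem hy
      have hi := hρ.integrable_scale (show 0 < (1 - c) / h y by positivity) y
      refine (norm_integral_le_integral_norm _).trans ?_
      calc ∫ x, ‖dualKernel ρ h Φ x y‖
          ≤ ∫ x, (1 + c) * ((1 + c) / (1 - c)) ^ n *
              (((1 - c) / h y) ^ n * ρ (((1 - c) / h y) • (y - x))) := by
            refine integral_mono_of_nonneg (Eventually.of_forall fun x => norm_nonneg _)
              (hi.const_mul _) (Eventually.of_forall fun x => ?_)
            by_cases hx : x ∈ S
            · refine (norm_dualKernel_le hρ hh hΦ1 (hΦΩ hx) y).trans ?_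
              dsimp only
              rw [mul_assoc]
              exact mul_le_mul_of_nonneg_left (mollKernel_le hρ hh (hΦΩ hx) hy) (by positivity)
            · dsimp only
              rw [hN0 x y fun h => hx h.1, norm_zero]
              have := hρ.nonneg (((1 - c) / h y) • (y - x))
              positivity
        _ = _ := by rw [integral_const_mul, hρ.integral_scale (by positivity), mul_one]
    · rw [hΘ0 y fun h => hy (hLΩ h), norm_zero]
      positivity
  · have hN0c : Continuous fun z : EuclideanSpace ℝ (Fin n) × EuclideanSpace ℝ (Fin n) =>
        mollKernel ρ h z.1 z.2 * vdiv n Φ z.1 := by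
      rw [← contDiff_zero (𝕜 := ℝ)]
      refine contDiff_of_contDiffAt_tsupport (K := S ×ˢ Set.univ)
        ((isClosed_tsupport Φ).prod isClosed_univ) (fun z hz => ?_) fun z hz => ?_
      · rw [vdiv_eq_zero_of_notMem fun h => hz ⟨h, Set.mem_univ _⟩, mul_zero]
      · exact ((contDiffAt_mollKernel hρ hh (hΦΩ hz.1)).of_le (by norm_num)).mul
          (contDiff_zero.2 ((continuous_vdiv hΦ).comp continuous_fst)).contDiffAt
    have hzero : ∀ x y, (x, y) ∉ S ×ˢ L → mollKernel ρ h x y * vdiv n Φ x = 0 := by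
      intro x y hxy
      by_cases hx : x ∈ S
      · rw [hkzero x hx y fun hy => hxy ⟨hx, hy⟩, zero_mul]
      · rw [vdiv_eq_zero_of_notMem hx, mul_zero]
    obtain ⟨C, hC⟩ := (hSc.prod hL).exists_bound_of_continuousOn hN0c.continuousOn
    have hbd : ∀ z : EuclideanSpace ℝ (Fin n) × EuclideanSpace ℝ (Fin n),
        ‖mollKernel ρ h z.1 z.2 * vdiv n Φ z.1‖ ≤ max C 0 := fun z => by
      by_cases hz : z ∈ S ×ˢ L
      · exact (hC z hz).trans (le_max_left _ _)
      · rw [hzero z.1 z.2 hz, norm_zero]; exact le_max_right _ _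
    have hfi : Integrable (L.indicator f) := (integrable_indicator_iff hL.measurableSet).2
      (hf.integrableOn_compact_subset hLΩ hL)
    have hSi : Integrable (S.indicator fun _ : EuclideanSpace ℝ (Fin n) => (1 : ℝ)) :=
      (integrable_indicator_iff hSc.measurableSet).2
        (integrableOn_const (hs := hSc.measure_lt_top.ne))
    have hprod := (hSi.mul_prod hfi).mul_bdd hN0c.aestronglyMeasurable
      (Eventually.of_forall hbd)
    have hswap := integral_integral_swap (f := fun x y => S.indicator (fun _ => (1 : ℝ)) x *
      L.indicator f y * (mollKernel ρ h x y * vdiv n Φ x)) hprod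
    have hpt : ∀ x y, S.indicator (fun _ => (1 : ℝ)) x *
        L.indicator f y * (mollKernel ρ h x y * vdiv n Φ x) =
          f y * (mollKernel ρ h x y * vdiv n Φ x) := by
      intro x y
      by_cases hxy : (x, y) ∈ S ×ˢ L
      · rw [Set.indicator_of_mem hxy.1, Set.indicator_of_mem hxy.2, one_mul]
      · rw [hzero x y hxy, mul_zero, mul_zero]
    simp only [hpt] at hswap
    rw [setIntegral_eq_integral_of_forall_compl_eq_zero,
      setIntegral_eq_integral_of_forall_compl_eq_zero]
    · calc ∫ x, varMollify ρ h f x * vdiv n Φ x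
          = ∫ x, ∫ y, f y * (mollKernel ρ h x y * vdiv n Φ x) := by
            refine integral_congr_ae (Eventually.of_forall fun x => ?_)
            simp only [varMollify, ← mul_assoc]
            rw [integral_mul_const]
        _ = ∫ y, f y * vdiv n Θ y := by
            rw [hswap]
            refine integral_congr_ae (Eventually.of_forall fun y => ?_)
            dsimp only
            rw [hdivk y, integral_const_mul, setIntegral_eq_integral_of_forall_compl_eq_zero]
            intro x hx
            exact hzero x y fun h => hx (hΦΩ h.1)
    · intro y hy
      rw [vdiv_eq_zero_of_notMem fun h => hy (hLΩ (hΘL h)), mul_zero]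
    · intro x hx
      rw [vdiv_eq_zero_of_notMem fun h => hx (hΦΩ h), mul_zero]

end Commutation

section Approximation

variable {n : ℕ} {Ω : Set (EuclideanSpace ℝ (Fin n))} {c : ℝ}
  {h ρ f : EuclideanSpace ℝ (Fin n) → ℝ}

lemma exists_isScale (hΩ : IsOpen Ω) : ∃ η : EuclideanSpace ℝ (Fin n) → ℝ,
    ∀ c : ℝ, 0 < c → c < 1 → IsScale Ω c (fun x => c * η x) := by
  obtain ⟨η, h1, h2, -, h4, h5⟩ := exists_smooth_dist hΩ
  refine ⟨η, fun c hc hc1 => ⟨contDiff_const.mul h1, fun x => mul_nonneg hc.le (h2 x), ?_, ?_,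
    hc, hc1⟩⟩
  · rw [← h4]
    ext x
    simp [hc.ne']
  · intro x y
    rw [← mul_sub, abs_mul, abs_of_pos hc]
    have := h5.dist_le_mul x y
    rw [Real.dist_eq, dist_eq_norm, NNReal.coe_one, one_mul] at this
    gcongr

lemma integral_mul_vdiv_le_variation (hV : variation n f Ω ≠ ⊤)
    {Φ : EuclideanSpace ℝ (Fin n) → EuclideanSpace ℝ (Fin n)}
    (hΦ : ContDiff ℝ 1 Φ) (hΦc : HasCompactSupport Φ) (hΦΩ : tsupport Φ ⊆ Ω)
    (hΦ1 : ∀ x, ‖Φ x‖ ≤ 1) : ∫ x in Ω, f x * vdiv n Φ x ≤ (variation n f Ω).toReal := by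
  refine (ENNReal.ofReal_le_iff_le_toReal hV).1 ?_
  unfold variation
  exact le_iSup_of_le Φ (le_iSup_of_le hΦ (le_iSup_of_le hΦc (le_iSup_of_le hΦΩ
    (le_iSup_of_le hΦ1 le_rfl))))

lemma lintegral_enorm_fderiv_varMollify_le (hρ : IsMollifier ρ) (hΩ : IsOpen Ω)
    (hh : IsScale Ω c h) (hf : LocallyIntegrableOn f Ω) (hV : variation n f Ω ≠ ⊤) :
    ∫⁻ x in Ω, ‖fderiv ℝ (varMollify ρ h f) x‖ₑ ≤
      ENNReal.ofReal ((1 + c) * ((1 + c) / (1 - c)) ^ n * (variation n f Ω).toReal) := by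
  refine lintegral_enorm_fderiv_le hΩ (contDiffOn_varMollify hρ hΩ hh hf) ?_
  intro Φ hΦ hΦc hΦΩ hΦ1
  obtain ⟨Θ, h1, h2, h3, h4, h5⟩ := exists_dual_field hρ hΩ hh hf hΦ hΦc hΦΩ hΦ1
  rw [h5]
  set M := (1 + c) * ((1 + c) / (1 - c)) ^ n with hM
  have hc := hh.pos
  have hc' : 0 < 1 - c := by linarith [hh.lt_one]
  have hM0 : 0 < M := by positivity
  have hs : tsupport (fun x => M⁻¹ • Θ x) ⊆ tsupport Θ :=
    closure_mono (Function.support_const_smul_subset M⁻¹ Θ)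
  have hk := integral_mul_vdiv_le_variation hV (Φ := fun x => M⁻¹ • Θ x) (h1.const_smul M⁻¹)
    (h2.mono' ((subset_tsupport _).trans hs)) (hs.trans h3) (fun x => by
      rw [norm_smul, norm_inv, Real.norm_of_nonneg hM0.le, inv_mul_le_iff₀ hM0, mul_one]
      exact h4 x)
  have he : ∀ x, vdiv n (fun x => M⁻¹ • Θ x) x = M⁻¹ * vdiv n Θ x := by
    intro x
    have := (h1.differentiable (by norm_num) x).hasFDerivAt.fun_const_smul M⁻¹
    simp [vdiv, this.fderiv, Finset.mul_sum]
  simp_rw [he] at hk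
  rw [← inv_mul_le_iff₀ hM0, ← integral_const_mul]
  refine le_trans (le_of_eq ?_) hk
  congr 1
  ext x
  ring

lemma abs_varMollify_sub_le (hρ : IsMollifier ρ) (hh : IsScale Ω c h)
    {x : EuclideanSpace ℝ (Fin n)} (hx : x ∈ Ω) (hf : IntegrableOn f (closedBall x (h x))) :
    |varMollify ρ h f x - f x| ≤
      ρ 0 * volume.real (closedBall (0 : EuclideanSpace ℝ (Fin n)) 1) *
        ⨍ y in closedBall x (h x), ‖f y - f x‖ := by
  have hp := hh.pos_of_mem hx
  set B := closedBall x (h x) with hB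
  have hBfin : volume B ≠ ⊤ := measure_closedBall_lt_top.ne
  have hz : ∀ y, y ∉ B → mollKernel ρ h x y = 0 := fun y hy =>
    mollKernel_eq_zero hρ hh hx (by
      rw [hB, mem_closedBall, dist_eq_norm, not_le] at hy; exact hy.le)
  have hcont : Continuous (fun y => mollKernel ρ h x y) := by
    have := hρ.contDiff.continuous
    unfold mollKernel
    fun_prop
  have hle : ∀ y, ‖mollKernel ρ h x y‖ ≤ (h x)⁻¹ ^ n * ρ 0 := by
    intro y
    rw [Real.norm_of_nonneg (mollKernel_nonneg hρ hh x y)]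
    exact mul_le_mul_of_nonneg_left (hρ.anti _ _ (by simp)) (by positivity)
  have hi : ∀ g : EuclideanSpace ℝ (Fin n) → ℝ, IntegrableOn g B →
      IntegrableOn (fun y => g y * mollKernel ρ h x y) B := fun g hg =>
    hg.mul_bdd hcont.aestronglyMeasurable (ae_of_all _ hle)
  have hc : IntegrableOn (fun _ => f x) B := integrableOn_const hBfin
  have e1 : varMollify ρ h f x = ∫ y in B, f y * mollKernel ρ h x y :=
    (setIntegral_eq_integral_of_forall_compl_eq_zero fun y hy => by rw [hz y hy, mul_zero]).symm
  have e2 : f x = ∫ y in B, f x * mollKernel ρ h x y := by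
    rw [setIntegral_eq_integral_of_forall_compl_eq_zero fun y hy => by rw [hz y hy, mul_zero],
      integral_const_mul, integral_mollKernel hρ hh hx, mul_one]
  have e3 : varMollify ρ h f x - f x = ∫ y in B, (f y - f x) * mollKernel ρ h x y := by
    conv_lhs => rw [e1, e2]
    rw [← integral_sub (hi _ hf) (hi _ hc)]
    simp_rw [sub_mul]
  have hvol : volume.real B = h x ^ n * volume.real (closedBall (0 : EuclideanSpace ℝ (Fin n)) 1) := by
    rw [hB, Measure.addHaar_real_closedBall' _ _ hp.le, finrank_euclideanSpace, Fintype.card_fin]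
  have hvol0 : 0 < volume.real (closedBall (0 : EuclideanSpace ℝ (Fin n)) 1) :=
    ENNReal.toReal_pos (measure_closedBall_pos _ _ one_pos).ne' measure_closedBall_lt_top.ne
  rw [e3, ← Real.norm_eq_abs]
  have hsub : IntegrableOn (fun y => f y - f x) B := hf.sub hc
  refine (norm_integral_le_of_norm_le (hsub.norm.const_mul ((h x)⁻¹ ^ n * ρ 0))
    (ae_of_all _ fun y => ?_)).trans (le_of_eq ?_)
  · rw [norm_mul, mul_comm]
    exact mul_le_mul_of_nonneg_right (hle y) (norm_nonneg _)
  · rw [integral_const_mul, setAverage_eq, hvol, smul_eq_mul, inv_pow]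
    have hpn := (pow_pos hp n).ne'
    generalize h x ^ n = a at *
    field_simp

lemma ae_tendsto_varMollify (hρ : IsMollifier ρ) (hΩ : IsOpen Ω)
    (hf : LocallyIntegrableOn f Ω) {h : ℕ → EuclideanSpace ℝ (Fin n) → ℝ} {c : ℕ → ℝ}
    (hh : ∀ j, IsScale Ω (c j) (h j)) (hlim : ∀ x ∈ Ω, Tendsto (fun j => h j x) atTop (𝓝 0)) :
    ∀ᵐ x ∂volume.restrict Ω, Tendsto (fun j => varMollify ρ (h j) f x) atTop (𝓝 (f x)) := by
  obtain ⟨K, hKc, -, hKΩ, -, hKex⟩ := exists_compact_exhaustion hΩ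
  have hint : ∀ m, IntegrableOn f (K m) := fun m =>
    hf.integrableOn_compact_subset (hKΩ m) (hKc m)
  have hae : ∀ᵐ x ∂(volume : Measure (EuclideanSpace ℝ (Fin n))), ∀ m,
      ∀ (w : ℕ → EuclideanSpace ℝ (Fin n)) (δ : ℕ → ℝ), Tendsto δ atTop (𝓝[>] 0) →
      (∀ᶠ j in atTop, x ∈ closedBall (w j) (1 * δ j)) →
      Tendsto (fun j => ⨍ y in closedBall (w j) (δ j),
        ‖(K m).indicator f y - (K m).indicator f x‖) atTop (𝓝 0) := by
    rw [ae_all_iff]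
    intro m
    have := IsUnifLocDoublingMeasure.ae_tendsto_average_norm_sub
      (volume : Measure (EuclideanSpace ℝ (Fin n)))
      (((hint m).integrable_indicator (hKc m).measurableSet).locallyIntegrable) 1
    filter_upwards [this] with x hx w δ h1 h2 using hx w δ h1 h2
  filter_upwards [ae_restrict_of_ae hae, ae_restrict_mem hΩ.measurableSet] with x hx hxΩ
  obtain ⟨r, hr, hrΩ⟩ := Metric.nhds_basis_closedBall.mem_iff.1 (hΩ.mem_nhds hxΩ)
  obtain ⟨m, hm⟩ := hKex _ (isCompact_closedBall x r) hrΩ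
  have hpos : ∀ j, 0 < h j x := fun j => (hh j).pos_of_mem hxΩ
  have hlx := hlim x hxΩ
  have hT := hx m (fun _ => x) (fun j => h j x)
    (tendsto_nhdsWithin_iff.2 ⟨hlx, Eventually.of_forall hpos⟩)
    (Eventually.of_forall fun j => mem_closedBall_self (by linarith [hpos j]))
  have hT' := hT.const_mul (ρ 0 * volume.real (closedBall (0 : EuclideanSpace ℝ (Fin n)) 1))
  rw [mul_zero] at hT'
  rw [tendsto_iff_norm_sub_tendsto_zero]
  refine squeeze_zero' (Eventually.of_forall fun _ => norm_nonneg _) ?_ hT'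
  filter_upwards [hlx.eventually_le_const hr] with j hj
  have hsub : closedBall x (h j x) ⊆ K m := (closedBall_subset_closedBall hj).trans hm
  have hxK : x ∈ K m := hm (mem_closedBall_self hr.le)
  refine (abs_varMollify_sub_le hρ (hh j) hxΩ ((hint m).mono_set hsub)).trans (le_of_eq ?_)
  congr 1
  rw [setAverage_eq, setAverage_eq]
  congr 1
  refine setIntegral_congr_fun measurableSet_closedBall fun y hy => ?_
  simp only [Set.indicator_of_mem hxK, Set.indicator_of_mem (hsub hy)]

/-- A function of finite variation is the a.e. limit of smooth functions whose total variations
do not exceed the variation of the function in the limit. -/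
lemma exists_smooth_approx (hΩ : IsOpen Ω) (hf : LocallyIntegrableOn f Ω)
    (hV : variation n f Ω ≠ ⊤) : ∃ u : ℕ → EuclideanSpace ℝ (Fin n) → ℝ,
      (∀ j, ContDiffOn ℝ 1 (u j) Ω) ∧
      (∀ τ : ℝ, 0 < τ → ∀ᶠ j in atTop,
        ∫⁻ x in Ω, ‖fderiv ℝ (u j) x‖ₑ ≤ ENNReal.ofReal ((variation n f Ω).toReal + τ)) ∧
      ∀ᵐ x ∂volume.restrict Ω, Tendsto (fun j => u j x) atTop (𝓝 (f x)) := by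
  obtain ⟨ρ, hρ⟩ := exists_isMollifier n
  obtain ⟨η, hη⟩ := exists_isScale hΩ
  set c : ℕ → ℝ := fun j => 1 / ((j : ℝ) + 2) with hc
  have hc0 : ∀ j, 0 < c j := fun j => by positivity
  have hc1 : ∀ j, c j < 1 := fun j => by
    rw [hc]; simp only; rw [div_lt_one (by positivity)]
    have : (0 : ℝ) ≤ j := j.cast_nonneg
    linarith
  have hclim : Tendsto c atTop (𝓝 0) :=
    tendsto_const_nhds.div_atTop (tendsto_natCast_atTop_atTop.atTop_add tendsto_const_nhds)
  have hh : ∀ j, IsScale Ω (c j) (fun x => c j * η x) := fun j => hη _ (hc0 j) (hc1 j)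
  refine ⟨fun j => varMollify ρ (fun x => c j * η x) f, fun j =>
    (contDiffOn_varMollify hρ hΩ (hh j) hf).of_le (by norm_num), ?_, ?_⟩
  · intro τ hτ
    have hT : Tendsto (fun j => (1 + c j) * ((1 + c j) / (1 - c j)) ^ n *
        (variation n f Ω).toReal) atTop (𝓝 ((1 + 0) * ((1 + 0) / (1 - 0)) ^ n *
        (variation n f Ω).toReal)) :=
      ((hclim.const_add 1).mul (((hclim.const_add 1).div (hclim.const_sub 1)
        (by norm_num)).pow n)).mul_const _
    have hlt : (1 + 0) * ((1 + 0) / (1 - 0)) ^ n * (variation n f Ω).toReal <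
        (variation n f Ω).toReal + τ := by norm_num [hτ]
    filter_upwards [hT.eventually_le_const hlt] with j hj
    exact (lintegral_enorm_fderiv_varMollify_le hρ hΩ (hh j) hf hV).trans
      (ENNReal.ofReal_le_ofReal hj)
  · refine ae_tendsto_varMollify hρ hΩ hf hh fun x _ => ?_
    simpa using hclim.mul_const (η x)

end Approximation

section CubeOscillation

variable {n : ℕ} {Q : Set (EuclideanSpace ℝ (Fin n))} {ε : ℝ}

lemma doubleOsc_smul {α : Type*} [MeasurableSpace α] (P : Measure α) (u : α → ℝ) {a : ℝ≥0∞}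
    (ha : a ≠ ⊤) : doubleOsc (a • P) u = a * a * doubleOsc P u := by
  unfold doubleOsc
  simp only [lintegral_smul_measure, smul_eq_mul]
  rw [lintegral_const_mul' _ _ ha, mul_assoc]

/-- The normalized Lebesgue measure on `Q`. -/
def avgMeasure (Q : Set (EuclideanSpace ℝ (Fin n))) : Measure (EuclideanSpace ℝ (Fin n)) :=
  (volume.restrict Q Set.univ)⁻¹ • volume.restrict Q

lemma IsCube.isProbabilityMeasure_avgMeasure (hε : 0 < ε) (hQ : IsCube n ε Q) :
    IsProbabilityMeasure (avgMeasure Q) := by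
  have hv := hQ.volume_eq hε
  refine ⟨?_⟩
  rw [avgMeasure, Measure.smul_apply, Measure.restrict_apply_univ, smul_eq_mul, hv]
  exact ENNReal.inv_mul_cancel (by simp; positivity) ENNReal.ofReal_ne_top

lemma avgMeasure_absolutelyContinuous (Q : Set (EuclideanSpace ℝ (Fin n))) :
    avgMeasure Q ≪ volume.restrict Q :=
  Measure.smul_absolutelyContinuous

/-- Scale invariant Poincaré inequality on cubes. -/
lemma IsCube.doubleOsc_le (hn : 1 ≤ n) (hε : 0 < ε) (hQ : IsCube n ε Q)
    {u : EuclideanSpace ℝ (Fin n) → ℝ} (hu : ContDiffOn ℝ 1 u Q) :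
    ENNReal.ofReal (ε ^ (n - 1)) * doubleOsc (avgMeasure Q) u ≤
      ENNReal.ofReal (2 ^ n * √n) * ∫⁻ x in Q, ‖fderiv ℝ u x‖ₑ := by
  have hv := hQ.volume_eq hε
  have hp : 0 < ε ^ n := by positivity
  have hinv : (ENNReal.ofReal (ε ^ n))⁻¹ = ENNReal.ofReal ((ε ^ n)⁻¹) :=
    (ENNReal.ofReal_inv_of_pos hp).symm
  have h := poincare_double hQ.isOpen hQ.convex hu (d := √n * ε) fun x hx y hy =>
    hQ.dist_le hε hy hx
  rw [avgMeasure, Measure.restrict_apply_univ, hv, hinv, doubleOsc_smul _ _ ENNReal.ofReal_ne_top]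
  refine (mul_le_mul_right (mul_le_mul_right h _) _).trans (le_of_eq ?_)
  rw [hv, show (2 : ℝ≥0∞) ^ n = ENNReal.ofReal (2 ^ n) by
    rw [ENNReal.ofReal_pow (by norm_num)]; norm_num]
  simp only [← mul_assoc]
  congr 1
  rw [← ENNReal.ofReal_mul (by positivity), ← ENNReal.ofReal_mul (by positivity),
    ← ENNReal.ofReal_mul (by positivity), ← ENNReal.ofReal_mul (by positivity),
    ← ENNReal.ofReal_mul (by positivity)]
  congr 1
  obtain ⟨m, rfl⟩ : ∃ m, n = m + 1 := ⟨n - 1, by omega⟩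
  rw [Nat.add_sub_cancel]
  field_simp
  ring

/-- The mean oscillation of `u + v` on a cube is controlled by the slope of an affine
approximation of `u`, the gradient of the remainder, and the oscillation of `v`. -/
lemma IsCube.oscillation_le (hn : 1 ≤ n) (hε : 0 < ε) (hQ : IsCube n ε Q)
    {u v : EuclideanSpace ℝ (Fin n) → ℝ} (hu : ContDiffOn ℝ 1 u Q)
    (hv : AEStronglyMeasurable v (volume.restrict Q)) (L : EuclideanSpace ℝ (Fin n) →L[ℝ] ℝ) :
    ENNReal.ofReal (ε ^ (n - 1)) *
      ENNReal.ofReal (⨍ x in Q, |u x + v x - ⨍ y in Q, (u y + v y)|) ≤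
      ENNReal.ofReal (1 / 4) * (∫⁻ _ in Q, ‖L‖ₑ) +
        ENNReal.ofReal (2 ^ n * √n) * (∫⁻ x in Q, ‖fderiv ℝ u x - L‖ₑ) +
        ENNReal.ofReal (ε ^ (n - 1)) * doubleOsc (avgMeasure Q) v := by
  have := hQ.isProbabilityMeasure_avgMeasure hε
  have hac := avgMeasure_absolutelyContinuous Q
  have hLu : ContDiffOn ℝ 1 (fun x => u x - L x) Q := hu.sub L.contDiff.contDiffOn
  have hLm : AEStronglyMeasurable (fun x => u x - L x) (avgMeasure Q) :=
    (hLu.continuousOn.aestronglyMeasurable hQ.isOpen.measurableSet).mono_ac hac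
  have hLi : Integrable L (avgMeasure Q) := by
    obtain ⟨x0, hx0⟩ := hQ.exists_center hε
    have hb : ∀ᵐ x ∂avgMeasure Q, ‖L x‖ ≤ ‖L‖ * (‖x0‖ + √n * ε) := by
      refine hac.ae_le ?_
      filter_upwards [ae_restrict_mem hQ.isOpen.measurableSet] with x hx
      refine (L.le_opNorm x).trans (mul_le_mul_of_nonneg_left ?_ (norm_nonneg _))
      have h1 := hQ.dist_le hε hx hx0
      have h2 := norm_add_le x0 (x - x0)
      rw [add_sub_cancel] at h2
      linarith
    exact Integrable.of_bound L.continuous.aestronglyMeasurable _ hb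
  have h1 := ofReal_integral_abs_add_le hLi (hLm.add (hv.mono_ac hac))
  have h2 := doubleOsc_add_le (v := v) hLm
  have e1 : ∀ x, L x + ((fun x => u x - L x) + v) x = u x + v x := fun x => by
    simp only [Pi.add_apply]; ring
  simp only [e1] at h1
  have h3 := hQ.inner_oscillation_le hε (clmVec L)
  simp only [inner_clmVec, norm_clmVec] at h3
  have h4 := hQ.doubleOsc_le hn hε hLu
  have e2 : ∫⁻ x in Q, ‖fderiv ℝ (fun x => u x - L x) x‖ₑ = ∫⁻ x in Q, ‖fderiv ℝ u x - L‖ₑ := by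
    refine setLIntegral_congr_fun hQ.isOpen.measurableSet fun x hx => ?_
    have hd : DifferentiableAt ℝ u x :=
      (hu.differentiableOn (by norm_num)).differentiableAt (hQ.isOpen.mem_nhds hx)
    rw [fderiv_fun_sub hd L.differentiableAt, L.fderiv]
  rw [e2] at h4
  have h5 : ENNReal.ofReal (ε ^ (n - 1)) * ENNReal.ofReal (⨍ x in Q, |L x - ⨍ y in Q, L y|) ≤
      ENNReal.ofReal (1 / 4) * ∫⁻ _ in Q, ‖L‖ₑ := by
    rw [setLIntegral_const, hQ.volume_eq hε, ← ofReal_norm, ← ENNReal.ofReal_mul (by positivity),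
      ← ENNReal.ofReal_mul (by positivity), ← ENNReal.ofReal_mul (by positivity)]
    refine ENNReal.ofReal_le_ofReal ((mul_le_mul_of_nonneg_left h3 (by positivity)).trans
      (le_of_eq ?_))
    obtain ⟨m, rfl⟩ : ∃ m, n = m + 1 := ⟨n - 1, by omega⟩
    rw [Nat.add_sub_cancel]
    ring
  calc _ ≤ ENNReal.ofReal (ε ^ (n - 1)) *
        (ENNReal.ofReal (⨍ x in Q, |L x - ⨍ y in Q, L y|) +
          (doubleOsc (avgMeasure Q) (fun x => u x - L x) + doubleOsc (avgMeasure Q) v)) :=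
        mul_le_mul_right (h1.trans (add_le_add_right h2 _)) _
    _ = _ := by rw [mul_add, mul_add, ← add_assoc]
    _ ≤ _ := add_le_add_left (add_le_add h5 h4) _

end CubeOscillation

section CubeFamily

variable {n : ℕ} {Ω : Set (EuclideanSpace ℝ (Fin n))}

lemma tsum_setLIntegral_le {ε : ℝ} (hε : 0 < ε) {F : Set (Set (EuclideanSpace ℝ (Fin n)))}
    (hF : ∀ Q ∈ F, IsCube n ε Q ∧ Q ⊆ Ω) (hd : F.Pairwise Disjoint)
    (w : EuclideanSpace ℝ (Fin n) → ℝ≥0∞) :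
    ∑' Q : F, ∫⁻ x in (Q : Set (EuclideanSpace ℝ (Fin n))), w x ≤ ∫⁻ x in Ω, w x := by
  have hd' : F.PairwiseDisjoint id := hd
  have hc : F.Countable := hd'.countable_of_isOpen (fun Q hQ => (hF Q hQ).1.isOpen)
    fun Q hQ => (hF Q hQ).1.exists_center hε
  have := lintegral_biUnion (μ := volume) hc (s := id)
    (fun Q hQ => (hF Q hQ).1.isOpen.measurableSet) hd' w
  simp only [id] at this
  rw [← this]
  exact lintegral_mono_set (Set.iUnion₂_subset fun Q hQ => (hF Q hQ).2)

lemma exists_const_approx_on_cubes {V : Type*} [NormedAddCommGroup V] [NormedSpace ℝ V]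
    {φ : EuclideanSpace ℝ (Fin n) → V} (hΩ : IsOpen Ω) (hφ : IntegrableOn φ Ω) {τ : ℝ≥0∞}
    (hτ : τ ≠ 0) : ∃ w : EuclideanSpace ℝ (Fin n) → ℝ≥0∞, ∫⁻ x in Ω, w x ≤ τ ∧
      ∃ ε₀ : ℝ, 0 < ε₀ ∧ ∀ ε, 0 < ε → ε < ε₀ → ∀ Q, IsCube n ε Q → Q ⊆ Ω →
        ∃ L : V, ∫⁻ x in Q, ‖φ x - L‖ₑ ≤ ∫⁻ x in Q, w x := by
  have hτ2 : τ / 2 ≠ 0 := by simpa using hτ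
  have hi := hφ.integrable_indicator hΩ.measurableSet
  obtain ⟨G, hGc, hGu, hGcont, -⟩ := hi.exists_hasCompactSupport_lintegral_sub_le hτ2
  set S := cthickening 1 (tsupport G) with hS
  have hSc : IsCompact S := hGc.isCompact.cthickening
  obtain ⟨δ, hδ, hδS⟩ := ENNReal.exists_nnreal_pos_mul_lt (hSc.measure_lt_top (μ := volume)).ne hτ2
  obtain ⟨r, hr, hru⟩ := Metric.uniformContinuous_iff.1
    (hGc.uniformContinuous_of_continuous hGcont) δ hδ
  have hmw : AEMeasurable fun x => ‖Ω.indicator φ x - G x‖ₑ :=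
    (hi.aestronglyMeasurable.sub (hGcont.aestronglyMeasurable (μ := volume))).enorm
  refine ⟨fun x => ‖Ω.indicator φ x - G x‖ₑ + S.indicator (fun _ => (δ : ℝ≥0∞)) x,
    ?_, min r 1 / (√n + 1), by positivity, ?_⟩
  · refine (setLIntegral_le_lintegral _ _).trans ?_
    rw [lintegral_add_left' hmw, lintegral_indicator hSc.measurableSet, setLIntegral_const]
    exact (add_le_add hGu hδS.le).trans (ENNReal.add_halves τ).le
  · intro ε hε hε0 Q hQ hQΩ
    obtain ⟨x₀, hx₀⟩ := hQ.exists_center hε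
    refine ⟨G x₀, setLIntegral_mono' hQ.isOpen.measurableSet fun x hx => ?_⟩
    rw [Set.indicator_of_mem (hQΩ hx)]
    have hdist : dist x x₀ < min r 1 := by
      rw [dist_eq_norm]
      rw [lt_div_iff₀ (by positivity)] at hε0
      nlinarith [hQ.dist_le hε hx hx₀]
    have h1 : ‖φ x - G x₀‖ₑ ≤ ‖φ x - G x‖ₑ + ‖G x - G x₀‖ₑ := by
      rw [← sub_add_sub_cancel (φ x) (G x) (G x₀)]
      exact enorm_add_le _ _
    refine h1.trans (add_le_add_right ?_ _)
    by_cases hxS : x ∈ S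
    · rw [Set.indicator_of_mem hxS, ← ofReal_norm, ← ENNReal.ofReal_coe_nnreal, ← dist_eq_norm]
      exact ENNReal.ofReal_le_ofReal (hru (hdist.trans_le (min_le_left _ _))).le
    · have h0 : G x₀ = 0 := by
        by_contra hne
        refine hxS (mem_cthickening_of_dist_le x x₀ 1 _ (subset_tsupport G hne) ?_)
        exact (hdist.trans_le (min_le_right _ _)).le
      have h0' : G x = 0 := by
        by_contra hne
        exact hxS (self_subset_cthickening _ (subset_tsupport G hne))
      simp [h0, h0']

/-- Poincaré inequality on a disjoint family of cubes for a.e. limits of smooth functions. -/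
lemma tsum_doubleOsc_le (hn : 1 ≤ n) (hΩ : IsOpen Ω) {ε : ℝ} (hε : 0 < ε)
    {F : Set (Set (EuclideanSpace ℝ (Fin n)))}
    (hF : ∀ Q ∈ F, IsCube n ε Q ∧ Q ⊆ Ω) (hd : F.Pairwise Disjoint)
    {u : ℕ → EuclideanSpace ℝ (Fin n) → ℝ} {v : EuclideanSpace ℝ (Fin n) → ℝ}
    (hu : ∀ j, ContDiffOn ℝ 1 (u j) Ω)
    (hv : ∀ᵐ x ∂volume.restrict Ω, Tendsto (fun j => u j x) atTop (𝓝 (v x))) {b : ℝ≥0∞}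
    (hb : ∀ᶠ j in atTop, ∫⁻ x in Ω, ‖fderiv ℝ (u j) x‖ₑ ≤ b) :
    ∑' Q : F, ENNReal.ofReal (ε ^ (n - 1)) * doubleOsc (avgMeasure (Q : Set _)) v ≤
      ENNReal.ofReal (2 ^ n * √n) * b := by
  have hac : ∀ Q : F, avgMeasure (Q : Set (EuclideanSpace ℝ (Fin n))) ≪ volume.restrict Ω :=
    fun Q => (avgMeasure_absolutelyContinuous _).trans
      (Measure.restrict_mono (hF Q Q.2).2 le_rfl).absolutelyContinuous
  have h1 : ∀ Q : F, ENNReal.ofReal (ε ^ (n - 1)) * doubleOsc (avgMeasure (Q : Set _)) v ≤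
      liminf (fun j => ENNReal.ofReal (2 ^ n * √n) *
        ∫⁻ x in (Q : Set (EuclideanSpace ℝ (Fin n))), ‖fderiv ℝ (u j) x‖ₑ) atTop := by
    intro Q
    obtain ⟨hQ, hQΩ⟩ := hF Q Q.2
    have := hQ.isProbabilityMeasure_avgMeasure hε
    refine (mul_le_mul_right (doubleOsc_le_liminf (u := u) (fun j => ?_)
      ((hac Q).ae_le hv)) _).trans ?_
    · exact (((hu j).continuousOn.aestronglyMeasurable hΩ.measurableSet)).mono_ac (hac Q)
    · rw [← ENNReal.liminf_const_mul_of_ne_top ENNReal.ofReal_ne_top]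
      refine liminf_le_liminf (Eventually.of_forall fun j => ?_)
      exact hQ.doubleOsc_le hn hε ((hu j).mono hQΩ)
  let _ : MeasurableSpace F := ⊤
  calc _ ≤ ∑' Q : F, liminf (fun j => ENNReal.ofReal (2 ^ n * √n) *
        ∫⁻ x in (Q : Set (EuclideanSpace ℝ (Fin n))), ‖fderiv ℝ (u j) x‖ₑ) atTop :=
        ENNReal.tsum_le_tsum h1
    _ ≤ liminf (fun j => ∑' Q : F, ENNReal.ofReal (2 ^ n * √n) *
        ∫⁻ x in (Q : Set (EuclideanSpace ℝ (Fin n))), ‖fderiv ℝ (u j) x‖ₑ) atTop := by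
        rw [← lintegral_count]
        simp_rw [← lintegral_count]
        exact lintegral_liminf_le fun j => measurable_from_top
    _ ≤ _ := by
        refine liminf_le_of_frequently_le' (hb.mono fun j hj => ?_).frequently
        rw [ENNReal.tsum_mul_left]
        exact mul_le_mul_right ((tsum_setLIntegral_le hε hF hd _).trans hj) _

/-- Upper bound for `κ_ε(u + v, Ω)` at small scales when `u` is smooth and `v` is an a.e. limit of
smooth functions with gradients bounded in `L¹` by `b`. -/
lemma eventually_kappa_add_le (hn : 1 ≤ n) (hΩ : IsOpen Ω)
    {w : EuclideanSpace ℝ (Fin n) → ℝ} (hw : ContDiffOn ℝ 1 w Ω)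
    (hfin : ∫⁻ x in Ω, ‖fderiv ℝ w x‖ₑ ≠ ⊤)
    {u : ℕ → EuclideanSpace ℝ (Fin n) → ℝ} {v : EuclideanSpace ℝ (Fin n) → ℝ}
    (hu : ∀ j, ContDiffOn ℝ 1 (u j) Ω)
    (hv : ∀ᵐ x ∂volume.restrict Ω, Tendsto (fun j => u j x) atTop (𝓝 (v x))) {b : ℝ≥0∞}
    (hb : ∀ᶠ j in atTop, ∫⁻ x in Ω, ‖fderiv ℝ (u j) x‖ₑ ≤ b) {τ : ℝ≥0∞} (hτ : τ ≠ 0) :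
    ∃ ε₀ : ℝ, 0 < ε₀ ∧ ∀ ε, 0 < ε → ε < ε₀ → kappa n ε (fun x => w x + v x) Ω ≤
      ENNReal.ofReal (1 / 4) * (∫⁻ x in Ω, ‖fderiv ℝ w x‖ₑ) +
        (1 + ENNReal.ofReal (2 ^ n * √n)) * τ + ENNReal.ofReal (2 ^ n * √n) * b := by
  have hi : IntegrableOn (fderiv ℝ w) Ω :=
    ⟨(measurable_fderiv ℝ w).aestronglyMeasurable, lt_top_iff_ne_top.2 hfin⟩
  obtain ⟨g, hg, ε₀, hε₀, hcube⟩ := exists_const_approx_on_cubes hΩ hi hτ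
  refine ⟨ε₀, hε₀, fun ε hε hεε₀ => ?_⟩
  have hvm : AEStronglyMeasurable v (volume.restrict Ω) :=
    aestronglyMeasurable_of_tendsto_ae atTop
      (fun j => (hu j).continuousOn.aestronglyMeasurable hΩ.measurableSet) hv
  set C := ENNReal.ofReal (2 ^ n * √n) with hC
  unfold kappa
  simp only [ENNReal.mul_iSup]
  refine iSup_le fun F => iSup_le fun hF => iSup_le fun hd => ?_
  rw [← ENNReal.tsum_mul_left]
  have h1 : ∀ Q : F, ENNReal.ofReal (ε ^ (n - 1)) *
      ENNReal.ofReal (⨍ x in (Q : Set (EuclideanSpace ℝ (Fin n))),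
        |w x + v x - ⨍ y in (Q : Set (EuclideanSpace ℝ (Fin n))), (w y + v y)|) ≤
      ENNReal.ofReal (1 / 4) * (∫⁻ x in (Q : Set (EuclideanSpace ℝ (Fin n))), ‖fderiv ℝ w x‖ₑ) +
        (1 + C) * (∫⁻ x in (Q : Set (EuclideanSpace ℝ (Fin n))), g x) +
        ENNReal.ofReal (ε ^ (n - 1)) * doubleOsc (avgMeasure (Q : Set _)) v := by
    intro Q
    obtain ⟨hQ, hQΩ⟩ := hF Q Q.2
    obtain ⟨L, hL⟩ := hcube ε hε hεε₀ Q hQ hQΩ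
    refine (hQ.oscillation_le hn hε (hw.mono hQΩ)
      (hvm.mono_measure (Measure.restrict_mono hQΩ le_rfl)) L).trans ?_
    refine add_le_add_left ?_ _
    have h2 : ∫⁻ _ in (Q : Set (EuclideanSpace ℝ (Fin n))), ‖L‖ₑ ≤
        (∫⁻ x in (Q : Set (EuclideanSpace ℝ (Fin n))), ‖fderiv ℝ w x‖ₑ) +
          ∫⁻ x in (Q : Set (EuclideanSpace ℝ (Fin n))), g x := by
      refine le_trans ?_ (add_le_add_right hL _)
      rw [← lintegral_add_left (measurable_fderiv ℝ w).enorm]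
      refine lintegral_mono fun x => ?_
      have := enorm_sub_le (a := fderiv ℝ w x) (b := fderiv ℝ w x - L)
      rwa [sub_sub_cancel] at this
    have hq : ENNReal.ofReal (1 / 4) ≤ 1 := ENNReal.ofReal_le_one.2 (by norm_num)
    calc _ ≤ ENNReal.ofReal (1 / 4) *
          ((∫⁻ x in (Q : Set (EuclideanSpace ℝ (Fin n))), ‖fderiv ℝ w x‖ₑ) +
          ∫⁻ x in (Q : Set (EuclideanSpace ℝ (Fin n))), g x) +
          C * (∫⁻ x in (Q : Set (EuclideanSpace ℝ (Fin n))), g x) := by gcongr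
      _ ≤ _ := by
        rw [mul_add, add_mul, add_assoc]
        gcongr
  refine (ENNReal.tsum_le_tsum h1).trans ?_
  rw [ENNReal.tsum_add, ENNReal.tsum_add, ENNReal.tsum_mul_left, ENNReal.tsum_mul_left]
  refine add_le_add (add_le_add ?_ ?_) (tsum_doubleOsc_le hn hΩ hε hF hd hu hv hb)
  · exact mul_le_mul_right (tsum_setLIntegral_le hε hF hd _) _
  · exact mul_le_mul_right ((tsum_setLIntegral_le hε hF hd _).trans hg) _

end CubeFamily

section Truncation

/-- A smooth bounded approximation of the identity on `ℝ`. -/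
def smoothTrunc (k t : ℝ) : ℝ := k * Real.arctan (t / k)

lemma hasDerivAt_smoothTrunc {k : ℝ} (hk : 0 < k) (t : ℝ) :
    HasDerivAt (smoothTrunc k) (1 / (1 + (t / k) ^ 2)) t := by
  have h := (((hasDerivAt_id t).div_const k).arctan).const_mul k
  refine h.congr_deriv ?_
  simp only [id]
  field_simp

lemma contDiff_smoothTrunc (k : ℝ) : ContDiff ℝ 1 (smoothTrunc k) :=
  contDiff_const.mul (Real.contDiff_arctan.comp (contDiff_id.div_const k))

lemma continuous_smoothTrunc (k : ℝ) : Continuous (smoothTrunc k) :=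
  (contDiff_smoothTrunc k).continuous

lemma abs_smoothTrunc_le {k : ℝ} (hk : 0 < k) (t : ℝ) : |smoothTrunc k t| ≤ |t| := by
  have hl : LipschitzWith 1 (smoothTrunc k) := lipschitzWith_of_nnnorm_deriv_le
    (fun t => (hasDerivAt_smoothTrunc hk t).differentiableAt) fun t => by
      rw [(hasDerivAt_smoothTrunc hk t).deriv, ← NNReal.coe_le_coe, coe_nnnorm, NNReal.coe_one,
        Real.norm_of_nonneg (by positivity), div_le_one (by positivity)]
      nlinarith [sq_nonneg (t / k)]
  have := hl.dist_le_mul t 0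
  simpa [smoothTrunc, Real.dist_eq] using this

lemma abs_smoothTrunc_le_const {k : ℝ} (hk : 0 < k) (t : ℝ) : |smoothTrunc k t| ≤ k * 2 := by
  rw [smoothTrunc, abs_mul, abs_of_pos hk]
  refine mul_le_mul_of_nonneg_left (abs_le.2 ⟨?_, ?_⟩) hk.le
  · linarith [Real.neg_pi_div_two_lt_arctan (t / k), Real.pi_le_four]
  · linarith [Real.arctan_lt_pi_div_two (t / k), Real.pi_le_four]

lemma tendsto_smoothTrunc (t : ℝ) :
    Tendsto (fun k : ℕ => smoothTrunc ((k : ℝ) + 1) t) atTop (𝓝 t) := by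
  have h0 : HasDerivAt (fun s : ℝ => Real.arctan (s * t)) t 0 := by
    simpa using ((hasDerivAt_id (0 : ℝ)).mul_const t).arctan
  have h1 := h0.tendsto_slope_zero_right
  have h2 : Tendsto (fun k : ℕ => ((k : ℝ) + 1)⁻¹) atTop (𝓝[>] 0) :=
    tendsto_nhdsWithin_iff.2 ⟨(tendsto_inv_atTop_zero.comp
      (tendsto_natCast_atTop_atTop.atTop_add tendsto_const_nhds)),
      Eventually.of_forall fun k => by simp only [Set.mem_Ioi]; positivity⟩
  refine (h1.comp h2).congr fun k => ?_
  simp [smoothTrunc, div_eq_inv_mul]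

variable {n : ℕ} {Ω : Set (EuclideanSpace ℝ (Fin n))}

lemma enorm_fderiv_smoothTrunc_add {u : EuclideanSpace ℝ (Fin n) → ℝ} {k : ℝ} (hk : 0 < k)
    {x : EuclideanSpace ℝ (Fin n)} (hu : DifferentiableAt ℝ u x) :
    ‖fderiv ℝ (fun x => smoothTrunc k (u x)) x‖ₑ +
      ‖fderiv ℝ (fun x => u x - smoothTrunc k (u x)) x‖ₑ = ‖fderiv ℝ u x‖ₑ := by
  have h1 : HasFDerivAt (fun x => smoothTrunc k (u x))
      ((1 / (1 + (u x / k) ^ 2)) • fderiv ℝ u x) x :=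
    (hasDerivAt_smoothTrunc hk (u x)).comp_hasFDerivAt x hu.hasFDerivAt
  have h2 := hu.hasFDerivAt.fun_sub h1
  rw [h1.fderiv, h2.fderiv]
  set d := 1 / (1 + (u x / k) ^ 2) with hd
  have hd0 : 0 ≤ d := by positivity
  have hd1 : d ≤ 1 := by
    rw [hd, div_le_one (by positivity)]
    nlinarith [sq_nonneg (u x / k)]
  have h3 : fderiv ℝ u x - d • fderiv ℝ u x = (1 - d) • fderiv ℝ u x := by
    rw [sub_smul, one_smul]
  rw [h3, ← ofReal_norm, ← ofReal_norm, ← ofReal_norm, norm_smul, norm_smul,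
    Real.norm_of_nonneg hd0, Real.norm_of_nonneg (sub_nonneg.2 hd1),
    ← ENNReal.ofReal_add (by positivity) (mul_nonneg (sub_nonneg.2 hd1) (norm_nonneg _))]
  congr 1
  ring

variable {f : EuclideanSpace ℝ (Fin n) → ℝ}

lemma LocallyIntegrableOn.integrableOn_mul_vdiv (hΩ : IsOpen Ω) (hf : LocallyIntegrableOn f Ω)
    {Φ : EuclideanSpace ℝ (Fin n) → EuclideanSpace ℝ (Fin n)} (hΦ : ContDiff ℝ 1 Φ)
    (hΦc : HasCompactSupport Φ) (hΦΩ : tsupport Φ ⊆ Ω) :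
    IntegrableOn (fun x => f x * vdiv n Φ x) Ω := by
  have hc := continuous_vdiv hΦ
  obtain ⟨M, hM⟩ := hΦc.isCompact.exists_bound_of_continuousOn hc.continuousOn
  have h1 : IntegrableOn (fun x => f x * vdiv n Φ x) (tsupport Φ) := by
    refine (hf.integrableOn_compact_subset hΦΩ hΦc.isCompact).mul_bdd
      hc.aestronglyMeasurable (c := M) ?_
    filter_upwards [ae_restrict_mem hΦc.isCompact.measurableSet] with x hx using hM x hx
  exact h1.of_forall_sdiff_eq_zero hΩ.measurableSet fun x hx => by
    rw [vdiv_eq_zero_of_notMem hx.2, mul_zero]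

/-- Truncating the values at a high level loses little variation: the discarded part of a suitable
smooth approximating sequence has small gradient in `L¹`. -/
lemma exists_smoothTrunc_gradient_le (hΩ : IsOpen Ω) (hf : LocallyIntegrableOn f Ω)
    {u : ℕ → EuclideanSpace ℝ (Fin n) → ℝ}
    (hu : ∀ j, ContDiffOn ℝ 1 (u j) Ω)
    (hlim : ∀ᵐ x ∂volume.restrict Ω, Tendsto (fun j => u j x) atTop (𝓝 (f x))) {τ : ℝ}
    (hτ : 0 < τ) (hgrad : ∀ᶠ j in atTop,
      ∫⁻ x in Ω, ‖fderiv ℝ (u j) x‖ₑ ≤ ENNReal.ofReal ((variation n f Ω).toReal + τ)) :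
    ∃ k : ℝ, 0 < k ∧ ∀ᶠ j in atTop,
      ∫⁻ x in Ω, ‖fderiv ℝ (fun x => u j x - smoothTrunc k (u j x)) x‖ₑ ≤
        ENNReal.ofReal (4 * τ) := by
  set V := (variation n f Ω).toReal with hVdef
  have hum : ∀ j, AEStronglyMeasurable (u j) (volume.restrict Ω) := fun j =>
    (hu j).continuousOn.aestronglyMeasurable hΩ.measurableSet
  have hfm : AEStronglyMeasurable f (volume.restrict Ω) :=
    aestronglyMeasurable_of_tendsto_ae atTop hum hlim
  obtain ⟨Ψ, hΨ, hΨc, hΨΩ, hΨ1, hΨV⟩ : ∃ Ψ : EuclideanSpace ℝ (Fin n) → EuclideanSpace ℝ (Fin n),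
      ContDiff ℝ 1 Ψ ∧ HasCompactSupport Ψ ∧ tsupport Ψ ⊆ Ω ∧ (∀ x, ‖Ψ x‖ ≤ 1) ∧
      V - τ < ∫ x in Ω, f x * vdiv n Ψ x := by
    by_contra! hcon
    have h1 : variation n f Ω ≤ ENNReal.ofReal (V - τ) := by
      conv_lhs => unfold variation
      exact iSup_le fun Φ => iSup_le fun h1 => iSup_le fun h2 => iSup_le fun h3 => iSup_le fun h4 =>
        ENNReal.ofReal_le_ofReal (hcon Φ h1 h2 h3 h4)
    rcases le_or_gt V τ with h | h
    · have h2 := hcon 0 contDiff_const HasCompactSupport.zero (by simp [tsupport]) (by simp)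
      have h3 : ∀ x, vdiv n (0 : EuclideanSpace ℝ (Fin n) → EuclideanSpace ℝ (Fin n)) x = 0 :=
        fun x => by
          refine vdiv_eq_zero_of_notMem ?_
          simp [tsupport]
      simp only [h3, mul_zero, integral_zero] at h2
      rw [ENNReal.ofReal_of_nonpos (by linarith)] at h1
      have h4 : V = 0 := by rw [hVdef, le_antisymm h1 bot_le]; simp
      linarith
    · have := ENNReal.toReal_le_of_le_ofReal (by linarith) h1
      linarith
  have hcv := continuous_vdiv hΨ
  have hvm : AEStronglyMeasurable (fun x => vdiv n Ψ x) (volume.restrict Ω) :=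
    hcv.aestronglyMeasurable
  have hvi : Integrable (fun x => vdiv n Ψ x) (volume.restrict Ω) := by
    have : Integrable (fun x => vdiv n Ψ x) := integrable_of_continuousOn_of_eq_zero hΨc.isCompact
      hcv.continuousOn fun x hx => vdiv_eq_zero_of_notMem hx
    exact this.integrableOn
  have hfi := LocallyIntegrableOn.integrableOn_mul_vdiv hΩ hf hΨ hΨc hΨΩ
  have hT1 : Tendsto (fun k : ℕ => ∫ x in Ω, smoothTrunc ((k : ℝ) + 1) (f x) * vdiv n Ψ x) atTop
      (𝓝 (∫ x in Ω, f x * vdiv n Ψ x)) := by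
    refine tendsto_integral_of_dominated_convergence (fun x => ‖f x * vdiv n Ψ x‖) (fun k => ?_)
      hfi.norm (fun k => ae_of_all _ fun x => ?_) (ae_of_all _ fun x => ?_)
    · exact ((continuous_smoothTrunc _).comp_aestronglyMeasurable hfm).mul hvm
    · rw [norm_mul, norm_mul]
      exact mul_le_mul_of_nonneg_right (abs_smoothTrunc_le (by positivity) _) (norm_nonneg _)
    · exact (tendsto_smoothTrunc _).mul_const _
  obtain ⟨k₀, hk₀⟩ := (hT1.eventually_const_lt hΨV).exists
  set k : ℝ := (k₀ : ℝ) + 1 with hkdef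
  have hk : 0 < k := by positivity
  refine ⟨k, hk, ?_⟩
  have hT2 : Tendsto (fun j => ∫ x in Ω, smoothTrunc k (u j x) * vdiv n Ψ x) atTop
      (𝓝 (∫ x in Ω, smoothTrunc k (f x) * vdiv n Ψ x)) := by
    refine tendsto_integral_of_dominated_convergence (fun x => k * 2 * ‖vdiv n Ψ x‖) (fun j => ?_)
      (hvi.norm.const_mul _) (fun j => ae_of_all _ fun x => ?_) ?_
    · exact ((continuous_smoothTrunc _).comp_aestronglyMeasurable (hum j)).mul hvm
    · rw [norm_mul]
      exact mul_le_mul_of_nonneg_right (abs_smoothTrunc_le_const hk _) (norm_nonneg _)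
    · filter_upwards [hlim] with x hx
      exact (((continuous_smoothTrunc k).tendsto _).comp hx).mul_const _
  filter_upwards [hT2.eventually_const_lt hk₀, hgrad] with j hj1 hj2
  have hcd : ContDiffOn ℝ 1 (fun x => smoothTrunc k (u j x)) Ω :=
    (contDiff_smoothTrunc k).comp_contDiffOn (hu j)
  have hsum : (∫⁻ x in Ω, ‖fderiv ℝ (fun x => smoothTrunc k (u j x)) x‖ₑ) +
      ∫⁻ x in Ω, ‖fderiv ℝ (fun x => u j x - smoothTrunc k (u j x)) x‖ₑ =
      ∫⁻ x in Ω, ‖fderiv ℝ (u j) x‖ₑ := by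
    rw [← lintegral_add_left (measurable_fderiv ℝ _).enorm]
    refine setLIntegral_congr_fun hΩ.measurableSet fun x hx => ?_
    exact enorm_fderiv_smoothTrunc_add hk
      (((hu j).differentiableOn (by norm_num)).differentiableAt (hΩ.mem_nhds hx))
  have hlow : ENNReal.ofReal (V - τ) ≤
      ∫⁻ x in Ω, ‖fderiv ℝ (fun x => smoothTrunc k (u j x)) x‖ₑ := by
    rw [setIntegral_mul_vdiv hΩ hcd hΨ hΨc hΨΩ, ← integral_neg] at hj1
    refine (ENNReal.ofReal_le_ofReal (hj1.le.trans (le_abs_self _))).trans ?_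
    rw [← Real.norm_eq_abs, ofReal_norm]
    refine (enorm_integral_le_lintegral_enorm _).trans (lintegral_mono fun x => ?_)
    rw [enorm_neg, ← ofReal_norm, ← ofReal_norm]
    refine ENNReal.ofReal_le_ofReal ((ContinuousLinearMap.le_opNorm _ _).trans ?_)
    exact mul_le_of_le_one_right (norm_nonneg _) (hΨ1 x)
  have hfinite : ∫⁻ x in Ω, ‖fderiv ℝ (fun x => smoothTrunc k (u j x)) x‖ₑ ≠ ⊤ :=
    ne_top_of_le_ne_top ENNReal.ofReal_ne_top ((le_self_add.trans hsum.le).trans hj2)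
  refine (ENNReal.add_le_add_iff_left hfinite).1 (hsum.le.trans (hj2.trans ?_))
  calc ENNReal.ofReal (V + τ) = ENNReal.ofReal ((V - τ) + 2 * τ) := by ring_nf
    _ ≤ ENNReal.ofReal (V - τ) + ENNReal.ofReal (2 * τ) := ENNReal.ofReal_add_le
    _ ≤ _ := add_le_add hlow (ENNReal.ofReal_le_ofReal (by linarith))

end Truncation

section Recovery

variable {n : ℕ} {Ω : Set (EuclideanSpace ℝ (Fin n))} {f : EuclideanSpace ℝ (Fin n) → ℝ}

lemma tendsto_eLpNorm_of_bounded {α : Type*} [MeasurableSpace α] {μ : Measure α}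
    [IsFiniteMeasure μ] {p : ℝ} (hp : 0 < p) {g : ℕ → α → ℝ}
    (hg : ∀ j, AEStronglyMeasurable (g j) μ) {b : ℝ} (hb : ∀ j x, |g j x| ≤ b)
    (hlim : ∀ᵐ x ∂μ, Tendsto (fun j => g j x) atTop (𝓝 0)) :
    Tendsto (fun j => eLpNorm (g j) (ENNReal.ofReal p) μ) atTop (𝓝 0) := by
  have hp0 : ENNReal.ofReal p ≠ 0 := by simpa using hp
  have h1 : Tendsto (fun j => ∫⁻ x, ‖g j x‖ₑ ^ p ∂μ) atTop (𝓝 (∫⁻ _, 0 ∂μ)) := by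
    refine tendsto_lintegral_of_dominated_convergence' (fun _ => ENNReal.ofReal b ^ p)
      (fun j => (hg j).enorm.pow_const p) (fun j => ae_of_all _ fun x => ?_) ?_ ?_
    · refine ENNReal.rpow_le_rpow ?_ hp.le
      rw [← ofReal_norm]
      exact ENNReal.ofReal_le_ofReal (hb j x)
    · rw [lintegral_const]
      exact ENNReal.mul_ne_top (ENNReal.rpow_ne_top_of_nonneg hp.le ENNReal.ofReal_ne_top)
        (measure_ne_top _ _)
    · filter_upwards [hlim] with x hx
      have := (hx.enorm.ennrpow_const p)
      simpa [ENNReal.zero_rpow_of_pos hp] using this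
  have h2 := h1.ennrpow_const (1 / p)
  rw [lintegral_zero, ENNReal.zero_rpow_of_pos (by positivity)] at h2
  refine h2.congr fun j => ?_
  rw [eLpNorm_eq_lintegral_rpow_enorm_toReal hp0 ENNReal.ofReal_ne_top,
    ENNReal.toReal_ofReal hp.le]

/-- A function of finite variation can be perturbed, by an arbitrarily small amount on a given
compact set, so that its BMO-type functional at small scales almost obeys the sharp bound. -/
lemma exists_kappa_approx (hn : 1 ≤ n) (hΩ : IsOpen Ω) (hf : LocallyIntegrableOn f Ω)
    (hV : variation n f Ω ≠ ⊤) {p : ℝ} (hp : 0 < p) {K : Set (EuclideanSpace ℝ (Fin n))}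
    (hK : IsCompact K) (hKΩ : K ⊆ Ω) {τ : ℝ} (hτ : 0 < τ) :
    ∃ g : EuclideanSpace ℝ (Fin n) → ℝ, LocallyIntegrableOn g Ω ∧
      (∀ K', IsCompact K' → K' ⊆ Ω →
        eLpNorm (fun x => g x - f x) (ENNReal.ofReal p) (volume.restrict K') < ⊤) ∧
      eLpNorm (fun x => g x - f x) (ENNReal.ofReal p) (volume.restrict K) ≤ ENNReal.ofReal τ ∧
      ∃ ε₀ : ℝ, 0 < ε₀ ∧ ∀ ε, 0 < ε → ε < ε₀ →
        kappa n ε g Ω ≤ variation n f Ω / 4 + ENNReal.ofReal τ := by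
  obtain ⟨u, hu, hgrad, hlim⟩ := exists_smooth_approx hΩ hf hV
  set C : ℝ := 2 ^ n * √n with hC
  have hC0 : 0 ≤ C := by positivity
  set σ : ℝ := τ / (2 + 5 * C) with hσdef
  have hσ : 0 < σ := by positivity
  obtain ⟨k, hk, hksmall⟩ := exists_smoothTrunc_gradient_le hΩ hf hu hlim hσ (hgrad σ hσ)
  set V := (variation n f Ω).toReal with hVdef
  have hum : ∀ j, AEStronglyMeasurable (u j) (volume.restrict Ω) := fun j =>
    (hu j).continuousOn.aestronglyMeasurable hΩ.measurableSet
  have hfm : AEStronglyMeasurable f (volume.restrict Ω) :=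
    aestronglyMeasurable_of_tendsto_ae atTop hum hlim
  have hcd : ∀ j, ContDiffOn ℝ 1 (fun x => smoothTrunc k (u j x)) Ω := fun j =>
    (contDiff_smoothTrunc k).comp_contDiffOn (hu j)
  have hdm : ∀ j, AEStronglyMeasurable (fun x => smoothTrunc k (u j x) - smoothTrunc k (f x))
      (volume.restrict Ω) := fun j =>
    ((continuous_smoothTrunc k).comp_aestronglyMeasurable (hum j)).sub
      ((continuous_smoothTrunc k).comp_aestronglyMeasurable hfm)
  have hdb : ∀ j x, |smoothTrunc k (u j x) - smoothTrunc k (f x)| ≤ k * 4 := fun j x => by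
    have h1 := abs_smoothTrunc_le_const hk (u j x)
    have h2 := abs_smoothTrunc_le_const hk (f x)
    have h3 := abs_sub (smoothTrunc k (u j x)) (smoothTrunc k (f x))
    linarith
  have hconv : Tendsto (fun j => eLpNorm (fun x => smoothTrunc k (u j x) - smoothTrunc k (f x))
      (ENNReal.ofReal p) (volume.restrict K)) atTop (𝓝 0) := by
    have : IsFiniteMeasure (volume.restrict K) := ⟨by
      rw [Measure.restrict_apply_univ]; exact hK.measure_lt_top⟩
    refine tendsto_eLpNorm_of_bounded hp
      (fun j => (hdm j).mono_measure (Measure.restrict_mono hKΩ le_rfl)) hdb ?_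
    filter_upwards [ae_restrict_of_ae_restrict_of_subset hKΩ hlim] with x hx
    have := (((continuous_smoothTrunc k).tendsto _).comp hx).sub_const (smoothTrunc k (f x))
    simpa using this
  obtain ⟨j, hj1, hj2⟩ := ((hconv.eventually_le_const
    (ENNReal.ofReal_pos.2 hτ)).and (hgrad σ hσ)).exists
  have hgle : ∫⁻ x in Ω, ‖fderiv ℝ (fun x => smoothTrunc k (u j x)) x‖ₑ ≤
      ENNReal.ofReal (V + σ) := by
    refine (setLIntegral_mono' hΩ.measurableSet fun x hx => ?_).trans hj2
    rw [← enorm_fderiv_smoothTrunc_add hk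
      (((hu j).differentiableOn (by norm_num)).differentiableAt (hΩ.mem_nhds hx))]
    exact le_self_add
  have hvlim : ∀ᵐ x ∂volume.restrict Ω, Tendsto (fun j => u j x - smoothTrunc k (u j x)) atTop
      (𝓝 (f x - smoothTrunc k (f x))) := by
    filter_upwards [hlim] with x hx
    exact hx.sub (((continuous_smoothTrunc k).tendsto _).comp hx)
  have hdiff : ∀ x, smoothTrunc k (u j x) + (f x - smoothTrunc k (f x)) - f x =
      smoothTrunc k (u j x) - smoothTrunc k (f x) := fun x => by ring
  refine ⟨fun x => smoothTrunc k (u j x) + (f x - smoothTrunc k (f x)), ?_, ?_, ?_, ?_⟩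
  · refine (hcd j).continuousOn.locallyIntegrableOn hΩ.measurableSet |>.add (hf.sub ?_)
    refine (locallyIntegrableOn_iff hΩ.isLocallyClosed).2 fun K' hK'Ω hK' => ?_
    refine Integrable.mono (hf.integrableOn_compact_subset hK'Ω hK')
      ((continuous_smoothTrunc k).comp_aestronglyMeasurable
        (hfm.mono_measure (Measure.restrict_mono hK'Ω le_rfl))) ?_
    exact ae_of_all _ fun x => abs_smoothTrunc_le hk _
  · intro K' hK' hK'Ω
    simp only [hdiff]
    have : IsFiniteMeasure (volume.restrict K') := ⟨by
      rw [Measure.restrict_apply_univ]; exact hK'.measure_lt_top⟩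
    exact (MemLp.of_bound ((hdm j).mono_measure (Measure.restrict_mono hK'Ω le_rfl)) (k * 4)
      (ae_of_all _ (hdb j))).2
  · simp only [hdiff]
    exact hj1
  · obtain ⟨ε₀, hε₀, h⟩ := eventually_kappa_add_le hn hΩ (hcd j)
      (ne_top_of_le_ne_top ENNReal.ofReal_ne_top hgle)
      (fun j => (hu j).sub (hcd j)) hvlim hksmall (τ := ENNReal.ofReal σ)
      (ENNReal.ofReal_pos.2 hσ).ne'
    refine ⟨ε₀, hε₀, fun ε hε hεε₀ => (h ε hε hεε₀).trans ?_⟩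
    have hV0 : 0 ≤ V := ENNReal.toReal_nonneg
    have hVe : variation n f Ω / 4 = ENNReal.ofReal (V / 4) := by
      rw [ENNReal.ofReal_div_of_pos (by norm_num), hVdef, ENNReal.ofReal_toReal hV]
      norm_num
    rw [hVe, ← ENNReal.ofReal_add (by positivity) hτ.le, ← hC]
    have h1 : (1 : ℝ≥0∞) + ENNReal.ofReal C = ENNReal.ofReal (1 + C) := by
      rw [ENNReal.ofReal_add (by norm_num) hC0, ENNReal.ofReal_one]
    calc _ ≤ ENNReal.ofReal (1 / 4) * ENNReal.ofReal (V + σ) +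
          (1 + ENNReal.ofReal C) * ENNReal.ofReal σ +
          ENNReal.ofReal C * ENNReal.ofReal (4 * σ) := by gcongr
      _ = ENNReal.ofReal (1 / 4 * (V + σ) + (1 + C) * σ + C * (4 * σ)) := by
          rw [h1, ← ENNReal.ofReal_mul (by norm_num), ← ENNReal.ofReal_mul (by positivity),
            ← ENNReal.ofReal_mul (by positivity), ← ENNReal.ofReal_add (by positivity)
            (by positivity), ← ENNReal.ofReal_add (by positivity) (by positivity)]
      _ ≤ _ := by
          refine ENNReal.ofReal_le_ofReal ?_
          have : σ * (2 + 5 * C) = τ := div_mul_cancel₀ _ (by positivity)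
          nlinarith

end Recovery

/-- Diagonal choice of an index along `ε → 0⁺`. -/
lemma exists_diagonal_index {e : ℕ → ℝ} (he : ∀ m, 0 < e m) : ∃ m : ℝ → ℕ,
    (∀ᶠ ε in 𝓝[>] (0 : ℝ), ε < e (m ε)) ∧ Tendsto m (𝓝[>] (0 : ℝ)) atTop := by
  set P : ℝ → ℕ → Prop := fun ε m => ∀ i ≤ m, ε < e i with hP
  set m : ℝ → ℕ := fun ε => Nat.findGreatest (P ε) ⌊ε⁻¹⌋₊ with hm
  have hPev : ∀ M, ∀ᶠ ε in 𝓝[>] (0 : ℝ), P ε M := fun M => by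
    have : ∀ᶠ ε in 𝓝[>] (0 : ℝ), ∀ i ∈ Finset.range (M + 1), ε < e i :=
      (Filter.eventually_all_finset _).2 fun i _ =>
        (eventually_lt_nhds (he i)).filter_mono nhdsWithin_le_nhds
    filter_upwards [this] with ε hε i hi using hε i (Finset.mem_range.2 (by omega))
  refine ⟨m, ?_, tendsto_atTop.2 fun M => ?_⟩
  · filter_upwards [hPev 0] with ε hε
    exact Nat.findGreatest_spec (P := P ε) (Nat.zero_le _) hε _ le_rfl
  · filter_upwards [hPev M, (tendsto_nat_floor_atTop.comp
      (tendsto_inv_nhdsGT_zero (𝕜 := ℝ))).eventually_ge_atTop M] with ε hε hM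
    exact Nat.le_findGreatest hM hε

/-- Upper bound for the `Γ_p`-limit: there is a recovery family
`f_ε` with `f_ε − f → 0` in `L^p_loc(Ω)` and
`limsup_{ε→0} κ_ε(f_ε, Ω) ≤ (1/4)·Var(f, Ω)`. -/
theorem gammaP_upper_bound
    (n : ℕ) (hn : 1 ≤ n)
    (Ω : Set (EuclideanSpace ℝ (Fin n))) (hΩ : IsOpen Ω)
    (p : ℝ) (hp : 1 ≤ p)
    (f : EuclideanSpace ℝ (Fin n) → ℝ) (hf : LocallyIntegrableOn f Ω volume) :
    ∃ F : ℝ → EuclideanSpace ℝ (Fin n) → ℝ,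
      (∀ ε, 0 < ε → LocallyIntegrableOn (F ε) Ω volume) ∧
      (∀ ε, 0 < ε → ∀ K, IsCompact K → K ⊆ Ω →
        eLpNorm (fun x => F ε x - f x) (ENNReal.ofReal p)
          (volume.restrict K) < ⊤) ∧
      (∀ K, IsCompact K → K ⊆ Ω →
        Tendsto (fun ε => eLpNorm (fun x => F ε x - f x) (ENNReal.ofReal p)
          (volume.restrict K)) (𝓝[>] (0:ℝ)) (𝓝 0)) ∧
      limsup (fun ε => kappa n ε (F ε) Ω) (𝓝[>] (0:ℝ)) ≤ variation n f Ω / 4 := by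
  by_cases hV : variation n f Ω = ⊤
  · refine ⟨fun _ => f, fun _ _ => hf, fun _ _ _ _ _ => by simp, fun _ _ _ => by simp, ?_⟩
    rw [hV, ENNReal.top_div_of_ne_top (by norm_num)]
    exact le_top
  obtain ⟨K, hKc, hKm, hKΩ, -, hKex⟩ := exists_compact_exhaustion hΩ
  have hp0 : 0 < p := by linarith
  choose g hgi hgK hgl e he hgκ using fun m : ℕ =>
    exists_kappa_approx hn hΩ hf hV hp0 (hKc m) (hKΩ m) (τ := 1 / ((m : ℝ) + 1)) (by positivity)
  obtain ⟨m, hme, hmlim⟩ := exists_diagonal_index he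
  have hlim : Tendsto (fun ε => ENNReal.ofReal (1 / ((m ε : ℝ) + 1))) (𝓝[>] (0 : ℝ)) (𝓝 0) := by
    have := ENNReal.tendsto_ofReal (tendsto_one_div_add_atTop_nhds_zero_nat.comp hmlim)
    simpa using this
  refine ⟨fun ε => g (m ε), fun ε _ => hgi _, fun ε _ => hgK _, fun K' hK' hK'Ω => ?_, ?_⟩
  · obtain ⟨M, hM⟩ := hKex K' hK' hK'Ω
    refine tendsto_of_tendsto_of_tendsto_of_le_of_le' tendsto_const_nhds hlim
      (Eventually.of_forall fun _ => bot_le) ?_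
    filter_upwards [hmlim.eventually_ge_atTop M] with ε hε
    exact (eLpNorm_mono_measure _ (Measure.restrict_mono (hM.trans (hKm hε)) le_rfl)).trans
      (hgl (m ε))
  · have h1 : Tendsto (fun ε => variation n f Ω / 4 + ENNReal.ofReal (1 / ((m ε : ℝ) + 1)))
        (𝓝[>] (0 : ℝ)) (𝓝 (variation n f Ω / 4)) := by
      simpa using hlim.const_add (variation n f Ω / 4)
    rw [← h1.limsup_eq]
    refine limsup_le_limsup ?_
    filter_upwards [hme, self_mem_nhdsWithin] with ε hε hε0
    exact hgκ (m ε) ε hε0 hε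

end
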